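/- arXiv:2106.07468 — 5 statements merged into one kernel-verified Lean document; each statement's English description precedes it below -/
import Mathlib

section
/- Under the Hermite-spectral Vlasov–Poisson system, the total mass is conserved: for all t ≥ 0, (d/dt) ∫₀ᴸ C₀(t,x) dx = 0. -/
open MeasureTheory Real

/-- The partial derivative of a `C¹` function in its first variable. -/
theorem hasDerivAt_fst_of_contDiff {f : ℝ → ℝ → ℝ}
    (hf : ContDiff ℝ 1 (fun p : ℝ × ℝ => f p.1 p.2)) (t x : ℝ) :
    HasDerivAt (fun τ => f τ x) (fderiv ℝ (fun p : ℝ × ℝ => f p.1 p.2) (t, x) (1, 0)) t := by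
  have h := (hf.differentiable one_ne_zero (t, x)).hasFDerivAt
  exact h.comp_hasDerivAt t ((hasDerivAt_id t).prodMk (hasDerivAt_const t x))

/-- The partial derivative of a `C¹` function in its second variable. -/
theorem hasDerivAt_snd_of_contDiff {f : ℝ → ℝ → ℝ}
    (hf : ContDiff ℝ 1 (fun p : ℝ × ℝ => f p.1 p.2)) (t x : ℝ) :
    HasDerivAt (fun y => f t y) (fderiv ℝ (fun p : ℝ × ℝ => f p.1 p.2) (t, x) (0, 1)) x := by
  have h := (hf.differentiable one_ne_zero (t, x)).hasFDerivAt
  exact h.comp_hasDerivAt x ((hasDerivAt_const x t).prodMk (hasDerivAt_id x))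

/-- Differentiation under the integral sign for a `C¹` integrand on a compact interval. -/
theorem hasDerivAt_intervalIntegral_of_contDiff {f : ℝ → ℝ → ℝ}
    (hf : ContDiff ℝ 1 (fun p : ℝ × ℝ => f p.1 p.2)) (a b t : ℝ) :
    HasDerivAt (fun τ => ∫ x in a..b, f τ x) (∫ x in a..b, deriv (fun τ => f τ x) t) t := by
  have hcont : Continuous fun p : ℝ × ℝ => deriv (fun τ => f τ p.2) p.1 := by
    simp_rw [fun p : ℝ × ℝ => (hasDerivAt_fst_of_contDiff hf p.1 p.2).deriv]
    exact (hf.continuous_fderiv one_ne_zero).clm_apply continuous_const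
  have hslice (τ : ℝ) : Continuous (f τ) :=
    hf.continuous.comp (Continuous.prodMk_right τ)
  obtain ⟨K, hK⟩ := ((isCompact_closedBall t 1).prod
    (isCompact_uIcc (a := a) (b := b))).exists_bound_of_continuousOn hcont.continuousOn
  refine (intervalIntegral.hasDerivAt_integral_of_dominated_loc_of_deriv_le
    (F' := fun τ x => deriv (fun τ => f τ x) τ) (bound := fun _ => K)
    (Metric.closedBall_mem_nhds t one_pos) ?_ ?_ ?_ ?_ ?_ ?_).2
  · exact .of_forall fun τ => (hslice τ).aestronglyMeasurable
  · exact (hslice t).intervalIntegrable a b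
  · exact (hcont.comp (Continuous.prodMk_right t)).aestronglyMeasurable
  · exact .of_forall fun x hx τ hτ => hK (τ, x) ⟨hτ, Set.uIoc_subset_uIcc hx⟩
  · exact intervalIntegrable_const
  · exact .of_forall fun x _ τ _ =>
      (hasDerivAt_fst_of_contDiff hf τ x).differentiableAt.hasDerivAt

/-- The integral of the derivative of a `C¹` periodic function over a period vanishes. -/
theorem intervalIntegral_deriv_snd_eq_zero_of_periodic {f : ℝ → ℝ → ℝ}
    (hf : ContDiff ℝ 1 (fun p : ℝ × ℝ => f p.1 p.2)) {L t : ℝ}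
    (hper : Function.Periodic (f t) L) :
    ∫ x in (0 : ℝ)..L, deriv (fun y => f t y) x = 0 := by
  have hcont : Continuous fun x => deriv (fun y => f t y) x := by
    simp_rw [fun x => (hasDerivAt_snd_of_contDiff hf t x).deriv]
    exact ((hf.continuous_fderiv one_ne_zero).comp (Continuous.prodMk_right t)).clm_apply
      continuous_const
  rw [intervalIntegral.integral_deriv_eq_sub
    (fun x _ => (hasDerivAt_snd_of_contDiff hf t x).differentiableAt)
    (hcont.intervalIntegrable 0 L), hper.eq, sub_self]

/-- Conservation of mass for the Hermite-spectral Vlasov–Poisson system. -/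
theorem hermite_mass_conservation
    (N_H : ℕ) (hNH : 3 ≤ N_H)
    (L α₀ γ ρ₀ : ℝ) (hL : 0 < L) (hα₀ : 0 < α₀) (hγ : 0 < γ)
    (C : ℤ → ℝ → ℝ → ℝ) (Φ E : ℝ → ℝ → ℝ) (α αd Esup : ℝ → ℝ)
    -- the Cₙ are C¹ and L-periodic in x, with Cₙ ≡ 0 for n < 0 and n ≥ N_H
    (hC1 : ∀ n : ℤ, ContDiff ℝ 1 (fun p : ℝ × ℝ => C n p.1 p.2))
    (hCper : ∀ (n : ℤ) (t x : ℝ), C n t (x + L) = C n t x)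
    (hCneg : ∀ n : ℤ, n < 0 → C n = 0)
    (hCbig : ∀ n : ℤ, (N_H : ℤ) ≤ n → C n = 0)
    -- Φ, E are C¹ and L-periodic in x, with E = -∂ₓΦ and ∂ₓE = C₀ - ρ₀
    (hΦ1 : ContDiff ℝ 1 (fun p : ℝ × ℝ => Φ p.1 p.2))
    (hE1 : ContDiff ℝ 1 (fun p : ℝ × ℝ => E p.1 p.2))
    (hΦper : ∀ t x : ℝ, Φ t (x + L) = Φ t x)
    (hEper : ∀ t x : ℝ, E t (x + L) = E t x)
    (hEΦ : ∀ t x : ℝ, E t x = - deriv (fun y => Φ t y) x)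
    (hPoisson : ∀ t x : ℝ, deriv (fun y => E t y) x = C 0 t x - ρ₀)
    -- the sup norm in x of E, assumed continuous in t
    (hEsup : ∀ t, Esup t = ⨆ x : ℝ, |E t x|)
    (hEbdd : ∀ t, BddAbove (Set.range fun x : ℝ => |E t x|))
    (hEsupCont : Continuous Esup)
    -- the scaling function α and its derivative α' = -(γ/2) ‖E‖_∞² α³
    (hα : ∀ t, α t = α₀ / Real.sqrt (1 + γ * ∫ s in (0:ℝ)..t, (Esup s) ^ 2))
    (hαd : ∀ t, αd t = -(γ / 2) * (Esup t) ^ 2 * (α t) ^ 3)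
    (hαderiv : ∀ t, 0 ≤ t → HasDerivAt α (αd t) t)
    -- the Hermite-spectral Vlasov system
    (hVlasov : ∀ n : ℤ, 0 ≤ n → n < (N_H : ℤ) → ∀ t x : ℝ, 0 ≤ t →
      deriv (fun τ => C n τ x) t
        - (αd t / α t) * ((n : ℝ) * C n t x + Real.sqrt (((n : ℝ) - 1) * (n : ℝ)) * C (n - 2) t x)
        + (1 / α t) * (Real.sqrt (n : ℝ) * deriv (fun y => C (n - 1) t y) x
            + Real.sqrt ((n : ℝ) + 1) * deriv (fun y => C (n + 1) t y) x)
        - α t * Real.sqrt (n : ℝ) * E t x * C (n - 1) t x = 0) :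
    ∀ t, 0 ≤ t → HasDerivAt (fun τ => ∫ x in (0:ℝ)..L, C 0 τ x) 0 t := by
  intro t ht
  have hC₀ (x : ℝ) :
      deriv (fun τ => C 0 τ x) t = -(1 / α t) * deriv (fun y => C 1 t y) x := by
    have h := hVlasov 0 le_rfl (by lia) t x ht
    simp at h
    simp only [one_div]
    linarith
  convert hasDerivAt_intervalIntegral_of_contDiff (hC1 0) 0 L t using 1
  simp_rw [hC₀]
  rw [intervalIntegral.integral_const_mul,
    intervalIntegral_deriv_snd_eq_zero_of_periodic (hC1 1) (hCper 1 t), mul_zero]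
end

section
/- For the Fourier–Hermite Galerkin semi-discretization of the Vlasov–Poisson system, mass, momentum and total energy are conserved: for all t ≥ 0, (d/dt) ∫₀ᴸ C₀(t,x) dx = 0, (d/dt) ∫₀ᴸ C₁(t,x)/α(t) dx = 0, and t ↦ (1/2) ∫₀ᴸ [ α(t)^{−2}(√2 C₂(t,x) + C₀(t,x)) + E(t,x)² ] dx is constant. -/
open MeasureTheory Real

/-- The space of real trigonometric polynomials of degree at most `Nx` on `[0,L]`. -/
def inV (L : ℝ) (Nx : ℕ) (u : ℝ → ℝ) : Prop :=
  ∃ a b : ℕ → ℝ, u = fun x => ∑ j ∈ Finset.range (Nx + 1),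
    (a j * Real.cos (2 * π * j * x / L) + b j * Real.sin (2 * π * j * x / L))

open Classical in
/-- A finite-dimensional space of functions is reconstructed from the values at finitely many
points. -/
theorem exists_interpolation {X : Type*} (V : Submodule ℝ (X → ℝ)) [FiniteDimensional ℝ V] :
    ∃ (s : Finset X) (e : s → X → ℝ), (∀ i, e i ∈ V) ∧
      ∀ u ∈ V, ∀ x, u x = ∑ i : s, u i * e i x := by
  let ev : X → V →ₗ[ℝ] ℝ := fun x => LinearMap.proj x ∘ₗ V.subtype
  obtain ⟨s, hs⟩ := Finset.exists_inf_eq_iInf fun x => LinearMap.ker (ev x)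
  let T : V →ₗ[ℝ] (s → ℝ) := LinearMap.pi fun i => ev i
  have hT : LinearMap.ker T = ⊥ := by
    rw [eq_bot_iff]
    intro v hv
    have h1 : v ∈ s.inf fun x => LinearMap.ker (ev x) := by
      rw [Finset.inf_eq_iInf]
      simp only [Submodule.mem_iInf, LinearMap.mem_ker]
      intro x hx
      exact congrFun (LinearMap.mem_ker.1 hv) ⟨x, hx⟩
    rw [hs] at h1
    simp only [Submodule.mem_iInf, LinearMap.mem_ker] at h1
    exact (Submodule.mem_bot ℝ).2 (Subtype.ext (funext h1))
  obtain ⟨g, hg⟩ := T.exists_leftInverse_of_injective hT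
  refine ⟨s, fun i => (g (Pi.single i 1) : X → ℝ), fun i => (g _).2, fun u hu x => ?_⟩
  have h := LinearMap.congr_fun hg ⟨u, hu⟩
  have h2 : T ⟨u, hu⟩ = ∑ i : s, u i • (Pi.single i 1 : s → ℝ) := by
    funext j
    simp [T, ev, Finset.sum_apply, Pi.single_apply]
  rw [LinearMap.comp_apply, h2, map_sum] at h
  have h3 := congrFun (congrArg Subtype.val h) x
  simpa [Finset.sum_apply] using h3.symm

theorem inV_contDiff {L : ℝ} {N : ℕ} {u : ℝ → ℝ} (hu : inV L N u) : ContDiff ℝ 1 u := by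
  obtain ⟨a, b, rfl⟩ := hu
  fun_prop

theorem inV_endpoints {L : ℝ} (hL : 0 < L) {N : ℕ} {u : ℝ → ℝ} (hu : inV L N u) : u L = u 0 := by
  obtain ⟨a, b, rfl⟩ := hu
  refine Finset.sum_congr rfl fun j _ => ?_
  have h : 2 * π * j * L / L = 0 + j * (2 * π) := by field_simp; ring
  rw [h, Real.cos_add_nat_mul_two_pi, Real.sin_add_nat_mul_two_pi]
  simp

theorem inV_one (L : ℝ) (N : ℕ) : inV L N fun _ => 1 := by
  refine ⟨Pi.single 0 1, 0, funext fun x => ?_⟩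
  rw [Finset.sum_eq_single 0] <;> simp +contextual

theorem inV_interpolation (L : ℝ) (N : ℕ) :
    ∃ (s : Finset ℝ) (e : s → ℝ → ℝ), (∀ i, Continuous (e i)) ∧
      ∀ u, inV L N u → ∀ x, u x = ∑ i : s, u i * e i x := by
  let B : Finset.range (N + 1) ⊕ Finset.range (N + 1) → ℝ → ℝ :=
    Sum.elim (fun j x => Real.cos (2 * π * (j : ℕ) * x / L))
      (fun j x => Real.sin (2 * π * (j : ℕ) * x / L))
  let V := Submodule.span ℝ (Set.range B)
  have : FiniteDimensional ℝ V := FiniteDimensional.span_of_finite ℝ (Set.finite_range B)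
  obtain ⟨s, e, he, h⟩ := exists_interpolation V
  refine ⟨s, e, fun i => ?_, fun u hu => h u ?_⟩
  · refine Submodule.span_induction (p := fun f _ => Continuous f) ?_ continuous_const
      (fun f g _ _ hf hg => hf.add hg) (fun c f _ hf => hf.const_smul c) (he i)
    rintro _ ⟨j | j, rfl⟩ <;> simp only [B, Sum.elim_inl, Sum.elim_inr] <;> fun_prop
  · obtain ⟨a, b, rfl⟩ := hu
    have hsum : (fun x => ∑ j ∈ Finset.range (N + 1),
        (a j * Real.cos (2 * π * j * x / L) + b j * Real.sin (2 * π * j * x / L)))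
        = ∑ j : Finset.range (N + 1), (a j • B (Sum.inl j) + b j • B (Sum.inr j)) := by
      funext x
      rw [← Finset.sum_coe_sort]
      simp [B, Finset.sum_apply]
    rw [hsum]
    exact Submodule.sum_mem _ fun j _ => Submodule.add_mem _
      (Submodule.smul_mem _ _ (Submodule.subset_span ⟨_, rfl⟩))
      (Submodule.smul_mem _ _ (Submodule.subset_span ⟨_, rfl⟩))

theorem integral_mul_deriv_of_inV {L : ℝ} (hL : 0 < L) {N : ℕ} {u v : ℝ → ℝ}
    (hu : inV L N u) (hv : inV L N v) :
    ∫ x in (0:ℝ)..L, u x * deriv v x = -∫ x in (0:ℝ)..L, v x * deriv u x := by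
  have hu' := inV_contDiff hu
  have hv' := inV_contDiff hv
  rw [intervalIntegral.integral_mul_deriv_eq_deriv_mul
    (fun x _ => (hu'.differentiable one_ne_zero x).hasDerivAt)
    (fun x _ => (hv'.differentiable one_ne_zero x).hasDerivAt)
    ((hu'.continuous_deriv le_rfl).intervalIntegrable _ _)
    ((hv'.continuous_deriv le_rfl).intervalIntegrable _ _),
    inV_endpoints hL hu, inV_endpoints hL hv, sub_self, zero_sub]
  simp only [mul_comm]

/-- Differentiation under the integral sign for families of trigonometric polynomials. -/
theorem hasDerivAt_integral_mul_of_inV {L : ℝ} {N : ℕ} {F : ℝ → ℝ → ℝ} {g : ℝ → ℝ}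
    (hF : ∀ t, inV L N (F t)) (hd : ∀ x, Differentiable ℝ fun t => F t x)
    (hF' : ∀ t, inV L N fun x => deriv (fun τ => F τ x) t) (hg : Continuous g) (t : ℝ) :
    HasDerivAt (fun τ => ∫ x in (0:ℝ)..L, F τ x * g x)
      (∫ x in (0:ℝ)..L, deriv (fun τ => F τ x) t * g x) t := by
  obtain ⟨s, e, he, h⟩ := inV_interpolation L N
  have key : ∀ u, inV L N u →
      ∫ x in (0:ℝ)..L, u x * g x = ∑ i : s, u i * ∫ x in (0:ℝ)..L, e i x * g x := by
    intro u hu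
    simp_rw [← intervalIntegral.integral_const_mul]
    rw [← intervalIntegral.integral_finsetSum
      fun i _ => ((((he i).fun_mul hg).const_mul (u i)).intervalIntegrable _ _)]
    refine intervalIntegral.integral_congr fun x _ => ?_
    rw [h u hu x, Finset.sum_mul]
    simp only [mul_assoc]
  rw [key _ (hF' t)]
  simp_rw [fun τ => key _ (hF τ)]
  exact HasDerivAt.fun_sum fun i _ => ((hd i t).hasDerivAt).mul_const _

theorem hasDerivAt_integral_sq_of_inV {L : ℝ} {N : ℕ} {F : ℝ → ℝ → ℝ}
    (hF : ∀ t, inV L N (F t)) (hd : ∀ x, Differentiable ℝ fun t => F t x)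
    (hF' : ∀ t, inV L N fun x => deriv (fun τ => F τ x) t) (t : ℝ) :
    HasDerivAt (fun τ => ∫ x in (0:ℝ)..L, F τ x ^ 2)
      (2 * ∫ x in (0:ℝ)..L, F t x * deriv (fun τ => F τ x) t) t := by
  obtain ⟨s, e, he, h⟩ := inV_interpolation L N
  have key : ∀ u v, inV L N u → Continuous v → ∫ x in (0:ℝ)..L, u x * v x
      = ∑ i : s, u i * ∫ x in (0:ℝ)..L, v x * e i x := by
    intro u v hu hv
    simp_rw [← intervalIntegral.integral_const_mul]
    rw [← intervalIntegral.integral_finsetSum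
      fun i _ => (((hv.fun_mul (he i)).const_mul (u i)).intervalIntegrable _ _)]
    refine intervalIntegral.integral_congr fun x _ => ?_
    rw [h u hu x, Finset.sum_mul]
    exact Finset.sum_congr rfl fun i _ => by ring
  have hc : ∀ τ, Continuous (F τ) := fun τ => (inV_contDiff (hF τ)).continuous
  have hc' := (inV_contDiff (hF' t)).continuous
  have h1 : HasDerivAt (fun τ => ∫ x in (0:ℝ)..L, F τ x ^ 2)
      (∑ i : s, (deriv (fun τ => F τ i) t * (∫ x in (0:ℝ)..L, F t x * e i x)
        + F t i * ∫ x in (0:ℝ)..L, deriv (fun τ => F τ x) t * e i x)) t := by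
    simp_rw [sq, fun τ => key _ _ (hF τ) (hc τ)]
    exact HasDerivAt.fun_sum fun i _ => ((hd i t).hasDerivAt).mul
      (hasDerivAt_integral_mul_of_inV hF hd hF' (he i) t)
  convert h1 using 1
  rw [Finset.sum_add_distrib, ← key _ _ (hF' t) (hc t), ← key _ _ (hF t) hc', two_mul]
  congr 1
  simp only [mul_comm]

/-- A derivative at `t ≥ 0` is determined by the values on `[0, ∞)`. -/
theorem hasDerivAt_unique_of_eqOn_nonneg {f g : ℝ → ℝ} {f' g' t : ℝ} (ht : 0 ≤ t)
    (hf : HasDerivAt f f' t) (hg : HasDerivAt g g' t) (h : ∀ s, 0 ≤ s → f s = g s) : f' = g' :=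
  (uniqueDiffWithinAt_Ici t).eq_deriv _ hf.hasDerivWithinAt
    (hg.hasDerivWithinAt.congr (fun s hs => h s (ht.trans hs)) (h t ht))

/-- Conservation of mass, momentum and total energy for the
Fourier–Hermite Galerkin semi-discretization of the Vlasov–Poisson system. -/
theorem fourier_hermite_conservations
    (N_H N_x : ℕ) (hNH : 3 ≤ N_H) (hNx : 1 ≤ N_x)
    (L α₀ γ ρ₀ : ℝ) (hL : 0 < L) (hα₀ : 0 < α₀) (hγ : 0 < γ)
    (C : ℤ → ℝ → ℝ → ℝ) (Φ E : ℝ → ℝ → ℝ) (α αd Esup : ℝ → ℝ)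
    -- Cₙ(t,·) ∈ V_{N_x}, differentiable in t, with Cₙ ≡ 0 for n < 0 and n ≥ N_H
    (hCV : ∀ (n : ℤ) (t : ℝ), inV L N_x (C n t))
    (hCdiff : ∀ (n : ℤ) (x : ℝ), Differentiable ℝ (fun t => C n t x))
    (hCneg : ∀ n : ℤ, n < 0 → C n = 0)
    (hCbig : ∀ n : ℤ, (N_H : ℤ) ≤ n → C n = 0)
    -- Φ(t,·), E(t,·), ∂ₜE(t,·) ∈ V_{N_x}, depending continuously on t
    (hΦV : ∀ t : ℝ, inV L N_x (Φ t))
    (hEV : ∀ t : ℝ, inV L N_x (E t))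
    (hEdiff : ∀ x : ℝ, Differentiable ℝ (fun t => E t x))
    (hEtV : ∀ t : ℝ, inV L N_x (fun x => deriv (fun τ => E τ x) t))
    (hΦcont : ∀ x : ℝ, Continuous (fun t => Φ t x))
    (hEcont : ∀ x : ℝ, Continuous (fun t => E t x))
    -- the sup norm in x of E, assumed continuous in t
    (hEsup : ∀ t, Esup t = ⨆ x : ℝ, |E t x|)
    (hEbdd : ∀ t, BddAbove (Set.range fun x : ℝ => |E t x|))
    (hEsupCont : Continuous Esup)
    -- the scaling function α and its derivative α' = -(γ/2) ‖E‖_∞² α³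
    (hα : ∀ t, α t = α₀ / Real.sqrt (1 + γ * ∫ s in (0:ℝ)..t, (Esup s) ^ 2))
    (hαd : ∀ t, αd t = -(γ / 2) * (Esup t) ^ 2 * (α t) ^ 3)
    (hαderiv : ∀ t, 0 ≤ t → HasDerivAt α (αd t) t)
    -- the Galerkin formulation of the Hermite-spectral Vlasov equation
    (hGalerkin : ∀ n : ℤ, 0 ≤ n → n < (N_H : ℤ) → ∀ t : ℝ, 0 ≤ t →
      ∀ φ : ℝ → ℝ, inV L N_x φ →
      HasDerivAt (fun τ => ∫ x in (0:ℝ)..L, C n τ x * φ x)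
        ((αd t / α t) * (∫ x in (0:ℝ)..L,
            ((n : ℝ) * C n t x + Real.sqrt (((n : ℝ) - 1) * (n : ℝ)) * C (n - 2) t x) * φ x)
          + (1 / α t) * (∫ x in (0:ℝ)..L,
            (Real.sqrt (n : ℝ) * C (n - 1) t x + Real.sqrt ((n : ℝ) + 1) * C (n + 1) t x)
              * deriv φ x)
          + α t * Real.sqrt (n : ℝ) * ∫ x in (0:ℝ)..L, E t x * C (n - 1) t x * φ x) t)
    -- the Galerkin formulation of the Poisson equation
    (hPoisson1 : ∀ t : ℝ, 0 ≤ t → ∀ η : ℝ → ℝ, inV L N_x η →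
      ∫ x in (0:ℝ)..L, Φ t x * deriv η x = ∫ x in (0:ℝ)..L, E t x * η x)
    (hPoisson2 : ∀ t : ℝ, 0 ≤ t → ∀ ζ : ℝ → ℝ, inV L N_x ζ →
      -∫ x in (0:ℝ)..L, E t x * deriv ζ x = ∫ x in (0:ℝ)..L, (C 0 t x - ρ₀) * ζ x) :
    ∀ t, 0 ≤ t →
      (HasDerivAt (fun τ => ∫ x in (0:ℝ)..L, C 0 τ x) 0 t)
      ∧ (HasDerivAt (fun τ => ∫ x in (0:ℝ)..L, C 1 τ x / α τ) 0 t)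
      ∧ ((1 / 2) * ∫ x in (0:ℝ)..L,
            ((1 / (α t) ^ 2) * (Real.sqrt 2 * C 2 t x + C 0 t x) + (E t x) ^ 2)
          = (1 / 2) * ∫ x in (0:ℝ)..L,
            ((1 / (α 0) ^ 2) * (Real.sqrt 2 * C 2 0 x + C 0 0 x) + (E 0 x) ^ 2)) := by
  have hint : ∀ {f : ℝ → ℝ}, Continuous f → IntervalIntegrable f volume 0 L :=
    fun hf => hf.intervalIntegrable _ _
  have hCc : ∀ n t, Continuous (C n t) := fun n t => (inV_contDiff (hCV n t)).continuous
  have hEc : ∀ t, Continuous (E t) := fun t => (inV_contDiff (hEV t)).continuous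
  have hαpos : ∀ t, 0 ≤ t → 0 < α t := by
    intro t ht
    rw [hα]
    have : 0 ≤ ∫ s in (0:ℝ)..t, (Esup s) ^ 2 :=
      intervalIntegral.integral_nonneg ht fun s _ => sq_nonneg _
    positivity
  have hCm : C (-1) = 0 := hCneg _ (by norm_num)
  have hN : (3 : ℤ) ≤ N_H := by exact_mod_cast hNH
  have mass : ∀ t, 0 ≤ t → HasDerivAt (fun τ => ∫ x in (0:ℝ)..L, C 0 τ x) 0 t := by
    intro t ht
    simpa using hGalerkin 0 le_rfl (by lia) t ht _ (inV_one L N_x)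
  have hC1 : ∀ t, 0 ≤ t → HasDerivAt (fun τ => ∫ x in (0:ℝ)..L, C 1 τ x)
      ((αd t / α t) * (∫ x in (0:ℝ)..L, C 1 t x) + α t * ∫ x in (0:ℝ)..L, E t x * C 0 t x) t := by
    intro t ht
    simpa using hGalerkin 1 (by norm_num) (by lia) t ht _ (inV_one L N_x)
  have hC2 : ∀ t, 0 ≤ t → HasDerivAt (fun τ => ∫ x in (0:ℝ)..L, C 2 τ x)
      ((αd t / α t) * (2 * (∫ x in (0:ℝ)..L, C 2 t x) + √2 * ∫ x in (0:ℝ)..L, C 0 t x)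
        + α t * √2 * ∫ x in (0:ℝ)..L, E t x * C 1 t x) t := by
    intro t ht
    have h := hGalerkin 2 (by norm_num) (by lia) t ht _ (inV_one L N_x)
    rw [← intervalIntegral.integral_const_mul, ← intervalIntegral.integral_const_mul,
      ← intervalIntegral.integral_add (hint ((hCc 2 t).const_mul _))
        (hint ((hCc 0 t).const_mul _))]
    have h21 : ((2 : ℝ) - 1) * 2 = 2 := by norm_num
    simpa [h21] using h
  have hEC0 : ∀ t, 0 ≤ t → ∫ x in (0:ℝ)..L, E t x * C 0 t x = 0 := by
    intro t ht
    have h0 : ∫ x in (0:ℝ)..L, E t x = 0 := by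
      simpa using (hPoisson1 t ht _ (inV_one L N_x)).symm
    have h1 := integral_mul_deriv_of_inV hL (hEV t) (hEV t)
    have h2 := hPoisson2 t ht _ (hEV t)
    have h3 : ∫ x in (0:ℝ)..L, (C 0 t x - ρ₀) * E t x
        = (∫ x in (0:ℝ)..L, E t x * C 0 t x) - ρ₀ * ∫ x in (0:ℝ)..L, E t x := by
      rw [← intervalIntegral.integral_const_mul, ← intervalIntegral.integral_sub
        (hint ((hEc t).fun_mul (hCc 0 t))) (hint ((hEc t).const_mul _))]
      exact intervalIntegral.integral_congr fun x _ => by ring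
    rw [h3, h0] at h2
    linarith
  have hEEt : ∀ t, 0 ≤ t → ∫ x in (0:ℝ)..L, E t x * deriv (fun τ => E τ x) t
      = -(1 / α t * ∫ x in (0:ℝ)..L, E t x * C 1 t x) := by
    intro t ht
    have hΦ' := (inV_contDiff (hΦV t)).continuous_deriv le_rfl
    have h1 := hPoisson1 t ht _ (hEtV t)
    have h2 := hPoisson1 t ht _ (hCV 1 t)
    rw [integral_mul_deriv_of_inV hL (hΦV t) (hEtV t)] at h1
    rw [integral_mul_deriv_of_inV hL (hΦV t) (hCV 1 t)] at h2
    have hG : HasDerivAt (fun τ => ∫ x in (0:ℝ)..L, C 0 τ x * Φ t x)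
        (1 / α t * ∫ x in (0:ℝ)..L, C 1 t x * deriv (Φ t) x) t := by
      simpa [hCm] using hGalerkin 0 le_rfl (by lia) t ht _ (hΦV t)
    have hP := (hasDerivAt_integral_mul_of_inV hEV hEdiff hEtV hΦ' t).neg
    have h3 := hasDerivAt_unique_of_eqOn_nonneg ht hP
      (hG.sub_const (ρ₀ * ∫ x in (0:ℝ)..L, Φ t x)) fun s hs => by
        rw [Pi.neg_apply, hPoisson2 s hs _ (hΦV t), ← intervalIntegral.integral_const_mul,
          ← intervalIntegral.integral_sub
            (hint ((hCc 0 s).fun_mul (inV_contDiff (hΦV t)).continuous))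
            (hint ((inV_contDiff (hΦV t)).continuous.const_mul _))]
        exact intervalIntegral.integral_congr fun x _ => by ring
    rw [← h1, h3, ← h2]
    ring
  have momentum : ∀ t, 0 ≤ t → HasDerivAt (fun τ => ∫ x in (0:ℝ)..L, C 1 τ x / α τ) 0 t := by
    intro t ht
    have hα0 := (hαpos t ht).ne'
    simp_rw [intervalIntegral.integral_div]
    refine ((hC1 t ht).fun_div (hαderiv t ht) hα0).congr_deriv ?_
    rw [hEC0 t ht]
    field_simp
    ring
  have energy_eq : ∀ t, ∫ x in (0:ℝ)..L,
      ((1 / (α t) ^ 2) * (√2 * C 2 t x + C 0 t x) + (E t x) ^ 2)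
      = (√2 * (∫ x in (0:ℝ)..L, C 2 t x) + ∫ x in (0:ℝ)..L, C 0 t x) / (α t) ^ 2
        + ∫ x in (0:ℝ)..L, (E t x) ^ 2 := by
    intro t
    rw [intervalIntegral.integral_add
      (hint ((((hCc 2 t).const_mul _).fun_add (hCc 0 t)).const_mul _)) (hint ((hEc t).fun_pow 2)),
      intervalIntegral.integral_const_mul, intervalIntegral.integral_add
      (hint ((hCc 2 t).const_mul _)) (hint (hCc 0 t)), intervalIntegral.integral_const_mul]
    ring
  have energy : ∀ t, 0 ≤ t → HasDerivAt (fun τ =>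
      (√2 * (∫ x in (0:ℝ)..L, C 2 τ x) + ∫ x in (0:ℝ)..L, C 0 τ x) / (α τ) ^ 2
        + ∫ x in (0:ℝ)..L, (E τ x) ^ 2) 0 t := by
    intro t ht
    have hα0 := (hαpos t ht).ne'
    have h2 : √2 ^ 2 = 2 := Real.sq_sqrt (by norm_num)
    refine (((((hC2 t ht).const_mul √2).fun_add (mass t ht)).fun_div ((hαderiv t ht).fun_pow 2)
      (pow_ne_zero 2 hα0)).fun_add (hasDerivAt_integral_sq_of_inV hEV hEdiff hEtV t)).congr_deriv ?_
    rw [hEEt t ht]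
    field_simp
    ring_nf
    simp only [h2]
    ring
  intro t ht
  refine ⟨mass t ht, momentum t ht, ?_⟩
  rw [energy_eq, energy_eq]
  congr 1
  exact constant_of_has_deriv_right_zero
    (fun s hs => (energy s hs.1).continuousAt.continuousWithinAt)
    (fun s hs => (energy s hs.1).hasDerivWithinAt) t ⟨ht, le_rfl⟩
end

section
/- The semi-discrete discontinuous Galerkin / Hermite scheme for the Vlasov equation conserves mass: for all t ≥ 0, (d/dt) ∫₀ᴸ C_{0,h}(t,x) dx = 0. -/
open MeasureTheory Real

/-- A cyclic shift of the summation index leaves a sum over `1, …, N` unchanged. -/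
theorem sum_Icc_cyclic_succ {M : Type*} [AddCommMonoid M] (G : ℕ → M) (N : ℕ) :
    ∑ j ∈ Finset.Icc 1 N, G (if j = N then 1 else j + 1) = ∑ j ∈ Finset.Icc 1 N, G j := by
  refine Finset.sum_bij' (fun j _ => if j = N then 1 else j + 1)
    (fun j _ => if j = 1 then N else j - 1) ?_ ?_ ?_ ?_ ?_
  · intro j hj; simp only [Finset.mem_Icc] at *; split_ifs <;> omega
  · intro j hj; simp only [Finset.mem_Icc] at *; split_ifs <;> omega
  · intro j hj; simp only [Finset.mem_Icc] at *; split_ifs <;> omega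
  · intro j hj; simp only [Finset.mem_Icc] at *; split_ifs <;> omega
  · intro j hj; rfl

/-- The semi-discrete DG/Hermite scheme for the Vlasov equation conserves mass. -/
theorem dg_hermite_mass_conservation
    (N_H k N_x : ℕ) (hNH : 3 ≤ N_H) (hNx : 1 ≤ N_x)
    (L α₀ γ : ℝ) (hL : 0 < L) (hα₀ : 0 < α₀) (hγ : 0 < γ)
    -- the mesh 0 = x_{1/2} < x_{3/2} < ⋯ < x_{N_x+1/2} = L; `X j` is the node x_{j+1/2}
    (X : ℕ → ℝ) (hX0 : X 0 = 0) (hXL : X N_x = L)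
    (hXmono : ∀ j, j < N_x → X j < X (j + 1))
    -- the piecewise-polynomial coefficients: `C n t j` is the polynomial of degree ≤ k
    -- representing C_{n,h}(t,·) on the cell I_j = [X (j-1), X j], j = 1, …, N_x
    (C : ℤ → ℝ → ℕ → Polynomial ℝ)
    (hdeg : ∀ (n : ℤ) (t : ℝ) (j : ℕ), (C n t j).natDegree ≤ k)
    (hCneg : ∀ n : ℤ, n < 0 → ∀ (t : ℝ) (j : ℕ), C n t j = 0)
    (hCbig : ∀ n : ℤ, (N_H : ℤ) ≤ n → ∀ (t : ℝ) (j : ℕ), C n t j = 0)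
    (hCdiff : ∀ (n : ℤ) (j : ℕ) (x : ℝ), Differentiable ℝ (fun t => (C n t j).eval x))
    -- the electric field, bounded on [0,L], with continuous sup norm `Einf`
    (Eh : ℝ → ℝ → ℝ) (Einf : ℝ → ℝ)
    (hEinf : ∀ t, Einf t = sSup {y | ∃ x ∈ Set.Icc (0:ℝ) L, y = |Eh t x|})
    (hEbdd : ∀ t, BddAbove {y | ∃ x ∈ Set.Icc (0:ℝ) L, y = |Eh t x|})
    (hEcont : Continuous Einf)
    -- the scaling function α and its derivative α' = -(γ/2) ‖E_h‖_∞² α³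
    (α αd : ℝ → ℝ)
    (hα : ∀ t, α t = α₀ / Real.sqrt (1 + γ * ∫ s in (0:ℝ)..t, (Einf s) ^ 2))
    (hαd : ∀ t, αd t = -(γ / 2) * (Einf t) ^ 2 * (α t) ^ 3)
    (hαderiv : ∀ t, 0 ≤ t → HasDerivAt α (αd t) t)
    -- traces: `Cm n t j` (resp. `Cp n t j`) is the left (resp. right) one-sided value
    -- of C_{n,h}(t,·) at the node x_{j-1/2}, with periodic identification
    (Cm Cp : ℤ → ℝ → ℕ → ℝ)
    (hCm : ∀ (n : ℤ) (t : ℝ) (j : ℕ),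
      Cm n t j = (C n t (if j = 1 then N_x else j - 1)).eval (if j = 1 then X N_x else X (j - 1)))
    (hCp : ∀ (n : ℤ) (t : ℝ) (j : ℕ), Cp n t j = (C n t j).eval (X (j - 1)))
    -- the numerical viscosity δₙ : δ₀ = 0 and δₙ = √(N_H)/α for 1 ≤ n ≤ N_H - 1
    (δ : ℤ → ℝ → ℝ)
    (hδ : ∀ (n : ℤ) (t : ℝ), δ n t = if n = 0 then 0 else Real.sqrt (N_H : ℝ) / α t)
    -- the numerical flux ĝₙ = (1/2)(gₙ⁻ + gₙ⁺ - δₙ (Cₙ⁺ - Cₙ⁻)) at the node x_{j-1/2}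
    (ghat : ℤ → ℝ → ℕ → ℝ)
    (hghat : ∀ (n : ℤ) (t : ℝ) (j : ℕ),
      ghat n t j = (1 / 2) *
        ((1 / α t) * (Real.sqrt ((n : ℝ) + 1) * Cm (n + 1) t j + Real.sqrt (n : ℝ) * Cm (n - 1) t j)
          + (1 / α t) * (Real.sqrt ((n : ℝ) + 1) * Cp (n + 1) t j + Real.sqrt (n : ℝ) * Cp (n - 1) t j)
          - δ n t * (Cp n t j - Cm n t j)))
    -- the semi-discrete DG scheme: for every cell j and test polynomial φ of degree ≤ k
    (hDG : ∀ n : ℤ, 0 ≤ n → n < (N_H : ℤ) → ∀ j ∈ Finset.Icc 1 N_x, ∀ t : ℝ, 0 ≤ t →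
      ∀ φ : Polynomial ℝ, φ.natDegree ≤ k →
      HasDerivAt (fun τ => ∫ x in X (j - 1)..X j, (C n τ j).eval x * φ.eval x)
        ((αd t / α t) * (∫ x in X (j - 1)..X j,
            ((n : ℝ) * (C n t j).eval x
              + Real.sqrt (((n : ℝ) - 1) * (n : ℝ)) * (C (n - 2) t j).eval x) * φ.eval x)
          - (-(∫ x in X (j - 1)..X j,
                (1 / α t) * (Real.sqrt ((n : ℝ) + 1) * (C (n + 1) t j).eval x
                  + Real.sqrt (n : ℝ) * (C (n - 1) t j).eval x)
                  * (Polynomial.derivative φ).eval x)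
              + ghat n t (if j = N_x then 1 else j + 1) * φ.eval (X j)
              - ghat n t j * φ.eval (X (j - 1)))
          + α t * Real.sqrt (n : ℝ) *
            ∫ x in X (j - 1)..X j, Eh t x * (C (n - 1) t j).eval x * φ.eval x) t) :
    ∀ t, 0 ≤ t →
      HasDerivAt
        (fun τ => ∑ j ∈ Finset.Icc 1 N_x, ∫ x in X (j - 1)..X j, (C 0 τ j).eval x) 0 t := by
  intro t ht
  have hcell : ∀ j ∈ Finset.Icc 1 N_x,
      HasDerivAt (fun τ => ∫ x in X (j - 1)..X j, (C 0 τ j).eval x)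
        (ghat 0 t j - ghat 0 t (if j = N_x then 1 else j + 1)) t := by
    intro j hj
    have h := hDG 0 le_rfl (by omega) j hj t ht 1 (by simp)
    simp only [Polynomial.eval_one, mul_one] at h
    convert h using 1
    simp
  have h := HasDerivAt.fun_sum hcell
  rwa [Finset.sum_sub_distrib, sum_Icc_cyclic_succ (ghat 0 t), sub_self] at h
end

section
/- The semi-discrete discontinuous Galerkin / Hermite scheme satisfies the dissipative weighted L² estimate: for all t ≥ 0, (1/2)(d/dt) Σ_{n=0}^{N_H−1} α(t) ∫₀ᴸ C_{n,h}(t,x)² dx + (α(t)/2) Σ_{n=1}^{N_H−1} Σ_{j=1}^{N_x} δ_n [C_{n,h}]²_{j−1/2} ≤ (1/(2γ)) Σ_{n=0}^{N_H−1} α(t) ∫₀ᴸ C_{n,h}(t,x)² dx. -/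
open MeasureTheory Real

open Polynomial in
/-- The bilinear form `(p, q) ↦ ∫ x in a..b, w x * p x * q x` on polynomials. -/
noncomputable def weightedForm (w : ℝ → ℝ) (a b : ℝ) (hw : IntervalIntegrable w volume a b) :
    ℝ[X] →ₗ[ℝ] ℝ[X] →ₗ[ℝ] ℝ :=
  have hint (p q : ℝ[X]) : IntervalIntegrable (fun x => w x * p.eval x * q.eval x) volume a b :=
    (hw.mul_continuousOn p.continuous.continuousOn).mul_continuousOn q.continuous.continuousOn
  LinearMap.mk₂ ℝ (fun p q => ∫ x in a..b, w x * p.eval x * q.eval x)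
    (fun p p' q => by
      rw [← intervalIntegral.integral_add (hint p q) (hint p' q)]
      congr 1; ext x; simp only [eval_add]; ring)
    (fun r p q => by
      rw [smul_eq_mul, ← intervalIntegral.integral_const_mul]
      congr 1; ext x; simp only [eval_smul, smul_eq_mul]; ring)
    (fun p q q' => by
      rw [← intervalIntegral.integral_add (hint p q) (hint p q')]
      congr 1; ext x; simp only [eval_add]; ring)
    (fun r p q => by
      rw [smul_eq_mul, ← intervalIntegral.integral_const_mul]
      congr 1; ext x; simp only [eval_smul, smul_eq_mul]; ring)

theorem weightedForm_apply (w : ℝ → ℝ) (a b : ℝ) (hw : IntervalIntegrable w volume a b)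
    (p q : Polynomial ℝ) :
    weightedForm w a b hw p q = ∫ x in a..b, w x * p.eval x * q.eval x := rfl

theorem weightedForm_comm (w : ℝ → ℝ) (a b : ℝ) (hw : IntervalIntegrable w volume a b)
    (p q : Polynomial ℝ) : weightedForm w a b hw p q = weightedForm w a b hw q p := by
  simp only [weightedForm_apply, mul_right_comm]

/-- The `L²(a, b)` inner product on polynomials. -/
noncomputable def massForm (a b : ℝ) : Polynomial ℝ →ₗ[ℝ] Polynomial ℝ →ₗ[ℝ] ℝ :=
  weightedForm (fun _ => 1) a b intervalIntegrable_const

theorem massForm_apply (a b : ℝ) (p q : Polynomial ℝ) :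
    massForm a b p q = ∫ x in a..b, p.eval x * q.eval x := by
  simp [massForm, weightedForm_apply]

theorem massForm_comm (a b : ℝ) (p q : Polynomial ℝ) : massForm a b p q = massForm a b q p :=
  weightedForm_comm _ _ _ _ _ _

theorem massForm_self_nonneg {a b : ℝ} (hab : a ≤ b) (p : Polynomial ℝ) :
    0 ≤ massForm a b p p := by
  rw [massForm_apply]
  exact intervalIntegral.integral_nonneg hab fun x _ => mul_self_nonneg _

theorem weightedForm_le_massForm {w : ℝ → ℝ} {a b e : ℝ} (hab : a ≤ b)
    (hw : IntervalIntegrable w volume a b) (hwe : ∀ x ∈ Set.Icc a b, |w x| ≤ e)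
    {s γ : ℝ} (hγ : 0 < γ) (p q : Polynomial ℝ) :
    s * weightedForm w a b hw p q
      ≤ γ / 2 * e ^ 2 * s ^ 2 * massForm a b q q + 1 / (2 * γ) * massForm a b p p := by
  simp only [massForm_apply, weightedForm_apply]
  rw [← intervalIntegral.integral_const_mul, ← intervalIntegral.integral_const_mul,
    ← intervalIntegral.integral_const_mul, ← intervalIntegral.integral_add
      (Continuous.intervalIntegrable (by fun_prop) _ _)
      (Continuous.intervalIntegrable (by fun_prop) _ _)]
  refine intervalIntegral.integral_mono_on hab
    (((hw.mul_continuousOn p.continuous.continuousOn).mul_continuousOn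
      q.continuous.continuousOn).const_mul s)
    (Continuous.intervalIntegrable (by fun_prop) _ _) fun x hx => ?_
  have hsq : w x ^ 2 ≤ e ^ 2 := sq_le_sq.2 ((hwe x hx).trans (le_abs_self e))
  have hnonneg : 0 ≤ γ / 2 * (s ^ 2 * (q.eval x) ^ 2) := by positivity
  have hyoung : 0 ≤ 1 / (2 * γ) * (γ * s * w x * q.eval x - p.eval x) ^ 2 := by positivity
  have hexpand : 1 / (2 * γ) * (γ * s * w x * q.eval x - p.eval x) ^ 2
      = γ / 2 * (s ^ 2 * (q.eval x) ^ 2) * w x ^ 2 - s * (w x * p.eval x * q.eval x)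
        + 1 / (2 * γ) * (p.eval x * p.eval x) := by
    field_simp; ring
  nlinarith [mul_le_mul_of_nonneg_left hsq hnonneg]

/-- A bounded weight can be replaced by an integrable one with the same bound without changing its
integrals against polynomials: if it is not integrable, all these integrals vanish. -/
theorem exists_intervalIntegrable_weight {w : ℝ → ℝ} {a b e : ℝ} (hab : a ≤ b) (he : 0 ≤ e)
    (hwe : ∀ x ∈ Set.Icc a b, |w x| ≤ e) :
    ∃ v : ℝ → ℝ, IntervalIntegrable v volume a b ∧ (∀ x ∈ Set.Icc a b, |v x| ≤ e) ∧
      ∀ p : Polynomial ℝ, ∫ x in a..b, w x * p.eval x = ∫ x in a..b, v x * p.eval x := by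
  by_cases hw : IntervalIntegrable w volume a b
  · exact ⟨w, hw, hwe, fun _ => rfl⟩
  refine ⟨fun _ => 0, intervalIntegrable_const, fun x _ => by simpa using he, fun p => ?_⟩
  rcases eq_or_ne p 0 with rfl | hp
  · simp
  rw [intervalIntegral.integral_undef]
  · simp
  intro hint
  apply hw
  rw [intervalIntegrable_iff_integrableOn_Ioc_of_le hab] at hint ⊢
  have hroots : ∀ᵐ x ∂(volume.restrict (Set.Ioc a b)), p.eval x ≠ 0 := by
    refine ae_restrict_of_ae ?_
    rw [ae_iff]
    simpa [Polynomial.IsRoot] using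
      (Polynomial.finite_setOfPred_isRoot hp).measure_zero (volume : Measure ℝ)
  refine Integrable.of_bound ?_ e ?_
  · refine (hint.aestronglyMeasurable.mul
      (p.continuous.measurable.inv.aestronglyMeasurable)).congr ?_
    filter_upwards [hroots] with x hx
    simp [mul_assoc, mul_inv_cancel₀ hx]
  · filter_upwards [ae_restrict_mem measurableSet_Ioc] with x hx
    exact hwe x (Set.Ioc_subset_Icc_self hx)

/-- If the values of a polynomial of bounded degree are differentiable in a parameter, a symmetric
bilinear form evaluated on its diagonal is differentiated by the product rule. -/
theorem hasDerivAt_bilin_self {k : ℕ} {P : ℝ → Polynomial ℝ} (hdeg : ∀ t, (P t).natDegree ≤ k)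
    (hP : ∀ x, Differentiable ℝ fun t => (P t).eval x)
    (B : Polynomial ℝ →ₗ[ℝ] Polynomial ℝ →ₗ[ℝ] ℝ) (hB : ∀ p q, B p q = B q p)
    {t d : ℝ} (hd : HasDerivAt (fun τ => B (P τ) (P t)) d t) :
    HasDerivAt (fun τ => B (P τ) (P τ)) (2 * d) t := by
  let ℓ : ℕ → Polynomial ℝ := Lagrange.basis (Finset.range (k + 1)) (fun i : ℕ => (i : ℝ))
  have hinterp (τ : ℝ) :
      P τ = ∑ i ∈ Finset.range (k + 1), (P τ).eval (i : ℝ) • ℓ i := by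
    have h := Lagrange.eq_interpolate (s := Finset.range (k + 1)) (v := fun i : ℕ => (i : ℝ))
      (f := P τ) (Nat.cast_injective.injOn) (by
        rw [Finset.card_range]
        exact (Polynomial.degree_le_natDegree).trans_lt
          (by exact_mod_cast Nat.lt_succ_of_le (hdeg τ)))
    conv_lhs => rw [h]
    simp [Lagrange.interpolate_apply, Polynomial.smul_eq_C_mul, ℓ]
  have heval (i : ℕ) : HasDerivAt (fun τ => (P τ).eval (i : ℝ))
      (deriv (fun τ => (P τ).eval (i : ℝ)) t) t := (hP i t).hasDerivAt
  have hlin (q : Polynomial ℝ) (τ : ℝ) :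
      B (P τ) q = ∑ i ∈ Finset.range (k + 1), (P τ).eval (i : ℝ) * B (ℓ i) q := by
    conv_lhs => rw [hinterp τ]
    simp [map_sum, LinearMap.sum_apply]
  have hderiv (q : Polynomial ℝ) : HasDerivAt (fun τ => B (P τ) q)
      (∑ i ∈ Finset.range (k + 1), deriv (fun τ => (P τ).eval (i : ℝ)) t * B (ℓ i) q) t := by
    simp only [hlin q]
    exact HasDerivAt.fun_sum fun i _ => (heval i).mul_const _
  have hdiag : HasDerivAt (fun τ => B (P τ) (P τ))
      (∑ i ∈ Finset.range (k + 1), (deriv (fun τ => (P τ).eval (i : ℝ)) t * B (ℓ i) (P t)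
        + (P t).eval (i : ℝ) * ∑ l ∈ Finset.range (k + 1),
            deriv (fun τ => (P τ).eval (l : ℝ)) t * B (ℓ l) (ℓ i))) t := by
    have hsum (τ : ℝ) : B (P τ) (P τ)
        = ∑ i ∈ Finset.range (k + 1), (P τ).eval (i : ℝ) * B (P τ) (ℓ i) := by
      rw [hlin (P τ) τ]
      exact Finset.sum_congr rfl fun i _ => by rw [hB]
    simp only [hsum]
    refine HasDerivAt.fun_sum fun i _ => ?_
    rw [hB (ℓ i) (P t)]
    exact (heval i).mul (hderiv (ℓ i))
  convert hdiag using 1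
  rw [hd.unique (hderiv (P t)), Finset.sum_add_distrib, two_mul]
  congr 1
  simp only [Finset.mul_sum]
  rw [Finset.sum_comm]
  refine Finset.sum_congr rfl fun l _ => ?_
  rw [hB (ℓ l) (P t), hlin (ℓ l) t, Finset.mul_sum]
  refine Finset.sum_congr rfl fun i _ => ?_
  rw [hB (ℓ l) (ℓ i)]
  ring

/-- The periodic predecessor of the cell index `j` in `{1, …, N}`. -/
def prevCell (N j : ℕ) : ℕ := if j = 1 then N else j - 1

theorem sum_periodic_shift (N : ℕ) (f : ℕ → ℕ → ℝ) :
    ∑ j ∈ Finset.Icc 1 N, f (if j = N then 1 else j + 1) j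
      = ∑ j ∈ Finset.Icc 1 N, f j (prevCell N j) := by
  refine Finset.sum_nbij' (fun j => if j = N then 1 else j + 1) (prevCell N) ?_ ?_ ?_ ?_ ?_
  · intro j hj; simp only [Finset.mem_Icc] at *; split_ifs <;> omega
  · intro j hj; simp only [Finset.mem_Icc, prevCell] at *; split_ifs <;> omega
  · intro j hj; simp only [Finset.mem_Icc, prevCell] at *; split_ifs <;> omega
  · intro j hj; simp only [Finset.mem_Icc, prevCell] at *; split_ifs <;> omega
  · intro j hj
    congr 1
    simp only [Finset.mem_Icc, prevCell] at *; split_ifs <;> omega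

/-- The discrete transport form with central flux on the periodic mesh with nodes `X`. -/
noncomputable def centralForm (X : ℕ → ℝ) (N : ℕ) (p q : ℕ → Polynomial ℝ) : ℝ :=
  ∑ j ∈ Finset.Icc 1 N,
    (-(∫ x in X (j - 1)..X j, (p j).eval x * (Polynomial.derivative (q j)).eval x)
      + 1 / 2 * ((p (prevCell N j)).eval (X (prevCell N j)) + (p j).eval (X (j - 1)))
        * ((q (prevCell N j)).eval (X (prevCell N j)) - (q j).eval (X (j - 1))))

theorem centralForm_zero_left (X : ℕ → ℝ) (N : ℕ) (q : ℕ → Polynomial ℝ) :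
    centralForm X N 0 q = 0 := by
  simp [centralForm]

theorem centralForm_antisymm (X : ℕ → ℝ) (N : ℕ) (p q : ℕ → Polynomial ℝ) :
    centralForm X N q p = -centralForm X N p q := by
  have hparts (j : ℕ) :
      (∫ x in X (j - 1)..X j, (p j).eval x * (Polynomial.derivative (q j)).eval x)
        + ∫ x in X (j - 1)..X j, (q j).eval x * (Polynomial.derivative (p j)).eval x
        = (p j).eval (X j) * (q j).eval (X j)
          - (p j).eval (X (j - 1)) * (q j).eval (X (j - 1)) := by
    rw [intervalIntegral.integral_mul_deriv_eq_deriv_mul (fun x _ => (p j).hasDerivAt x)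
      (fun x _ => (q j).hasDerivAt x) (Continuous.intervalIntegrable (by fun_prop) _ _)
      (Continuous.intervalIntegrable (by fun_prop) _ _)]
    simp only [mul_comm (Polynomial.eval _ (q j)) (Polynomial.eval _ (Polynomial.derivative _))]
    rw [sub_add_cancel]
  have hshift := sum_periodic_shift N fun _ i => (p i).eval (X i) * (q i).eval (X i)
  have hparts_sum := Finset.sum_congr rfl fun j (_ : j ∈ Finset.Icc 1 N) => hparts j
  rw [Finset.sum_sub_distrib, hshift, ← Finset.sum_sub_distrib] at hparts_sum
  rw [eq_neg_iff_add_eq_zero, centralForm, centralForm, ← Finset.sum_add_distrib,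
    ← sub_eq_zero.2 hparts_sum.symm, ← Finset.sum_sub_distrib]
  exact Finset.sum_congr rfl fun j _ => by ring

theorem sum_dg_transport (X : ℕ → ℝ) (N : ℕ) (a u v δ : ℝ) (p r q : ℕ → Polynomial ℝ)
    (ghat : ℕ → ℝ)
    (hghat : ∀ j, ghat j = 1 / 2 *
      (a * (u * (p (prevCell N j)).eval (X (prevCell N j))
          + v * (r (prevCell N j)).eval (X (prevCell N j)))
        + a * (u * (p j).eval (X (j - 1)) + v * (r j).eval (X (j - 1)))
        - δ * ((q j).eval (X (j - 1)) - (q (prevCell N j)).eval (X (prevCell N j))))) :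
    ∑ j ∈ Finset.Icc 1 N,
      (-(∫ x in X (j - 1)..X j, a * (u * (p j).eval x + v * (r j).eval x)
          * (Polynomial.derivative (q j)).eval x)
        + ghat (if j = N then 1 else j + 1) * (q j).eval (X j)
        - ghat j * (q j).eval (X (j - 1)))
      = a * (u * centralForm X N p q + v * centralForm X N r q)
        + 1 / 2 * ∑ j ∈ Finset.Icc 1 N,
          δ * ((q j).eval (X (j - 1)) - (q (prevCell N j)).eval (X (prevCell N j))) ^ 2 := by
  have hint (j : ℕ) : ∫ x in X (j - 1)..X j, a * (u * (p j).eval x + v * (r j).eval x)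
        * (Polynomial.derivative (q j)).eval x
      = a * (u * (∫ x in X (j - 1)..X j, (p j).eval x * (Polynomial.derivative (q j)).eval x)
        + v * ∫ x in X (j - 1)..X j, (r j).eval x * (Polynomial.derivative (q j)).eval x) := by
    have h := massForm_apply (X (j - 1)) (X j) (a • (u • p j + v • r j))
      (Polynomial.derivative (q j))
    simp only [map_add, map_smul, LinearMap.add_apply, LinearMap.smul_apply, smul_eq_mul,
      Polynomial.eval_add, Polynomial.eval_smul] at h
    rw [← h, massForm_apply, massForm_apply]
  have hshift := sum_periodic_shift N fun i j => ghat i * (q j).eval (X j)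
  simp only [hint]
  rw [Finset.sum_sub_distrib, Finset.sum_add_distrib, hshift]
  simp only [centralForm, Finset.mul_sum]
  rw [← Finset.sum_add_distrib, ← Finset.sum_sub_distrib, ← Finset.sum_add_distrib,
    Finset.mul_sum, ← Finset.sum_add_distrib]
  refine Finset.sum_congr rfl fun j _ => ?_
  rw [hghat j]
  ring

theorem sum_hermite_antisymm (F : ℤ → ℤ → ℝ) (hF : ∀ m n, F n m = -F m n) (N : ℕ) :
    ∑ n ∈ Finset.range N, (√((n : ℝ) + 1) * F (n + 1) n + √(n : ℝ) * F (n - 1) n)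
      = √(N : ℝ) * F N (N - 1) := by
  induction N with
  | zero => simp
  | succ N ih =>
    rw [Finset.sum_range_succ, ih, hF N (N - 1)]
    push_cast
    rw [add_sub_cancel_right]
    ring

theorem sum_hermite_symm (F : ℤ → ℤ → ℝ) (hF : ∀ m n, F n m = F m n) (N : ℕ) :
    ∑ n ∈ Finset.range N, (√((n : ℝ) + 1) * F n (n + 1) + √(n : ℝ) * F n (n - 1))
      = 2 * ∑ n ∈ Finset.range N, √(n : ℝ) * F (n - 1) n + √(N : ℝ) * F (N - 1) N := by
  induction N with
  | zero => simp
  | succ N ih =>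
    rw [Finset.sum_range_succ, Finset.sum_range_succ, ih, hF N (N - 1), hF (N - 1) N]
    push_cast
    rw [add_sub_cancel_right]
    ring

theorem sum_hermite_sq (F : ℤ → ℤ → ℝ) (N : ℕ) :
    ∑ n ∈ Finset.range N, (((n : ℝ) + 1) * F (n + 1) (n + 1) + (n : ℝ) * F (n - 1) (n - 1)
        + 2 * √((n : ℝ) * ((n : ℝ) + 1)) * F (n - 1) (n + 1))
      = ∑ n ∈ Finset.range N, ((2 * (n : ℝ) + 1) * F n n
          + 2 * √(((n : ℝ) - 1) * (n : ℝ)) * F (n - 2) n)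
        + (N : ℝ) * F N N - (N : ℝ) * F (N - 1) (N - 1)
        + 2 * √(((N : ℝ) - 1) * (N : ℝ)) * F (N - 2) N := by
  induction N with
  | zero => simp
  | succ N ih =>
    rw [Finset.sum_range_succ, Finset.sum_range_succ, ih]
    have hshift : (N : ℤ) + 1 - 2 = N - 1 := by ring
    push_cast
    rw [add_sub_cancel_right, add_sub_cancel_right, hshift]
    ring

/-- The field term of the Hermite system is controlled by the time-scaling terms. -/
theorem hermite_field_le {w : ℝ → ℝ} {a b e : ℝ} (hab : a ≤ b) (he : 0 ≤ e)
    (hwe : ∀ x ∈ Set.Icc a b, |w x| ≤ e) {s γ : ℝ} (hγ : 0 < γ) (N : ℕ)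
    (c : ℤ → Polynomial ℝ) (hc : c N = 0) :
    s * ∑ n ∈ Finset.range N, √(n : ℝ) * ∫ x in a..b, w x * (c (n - 1)).eval x * (c n).eval x
      ≤ γ / 2 * e ^ 2 * s ^ 2 * ∑ n ∈ Finset.range N, (((n : ℝ) + 1 / 2) * massForm a b (c n) (c n)
          + √(((n : ℝ) - 1) * (n : ℝ)) * massForm a b (c (n - 2)) (c n))
        + 1 / (2 * γ) * ∑ n ∈ Finset.range N, massForm a b (c n) (c n) := by
  obtain ⟨v, hv, hve, hwv⟩ := exists_intervalIntegrable_weight hab he hwe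
  have hfield (n : ℤ) : ∫ x in a..b, w x * (c (n - 1)).eval x * (c n).eval x
      = weightedForm v a b hv (c (n - 1)) (c n) := by
    rw [weightedForm_apply]
    simpa [mul_assoc] using hwv (c (n - 1) * c n)
  simp only [hfield]
  let β (n : ℕ) : Polynomial ℝ := √((n : ℝ) + 1) • c (n + 1) + √(n : ℝ) • c (n - 1)
  have hW := sum_hermite_symm (fun m n => weightedForm v a b hv (c m) (c n))
    (fun m n => weightedForm_comm _ _ _ _ _ _) N
  have hM := sum_hermite_sq (fun m n => massForm a b (c m) (c n)) N
  have hβW (n : ℕ) : weightedForm v a b hv (c n) (β n)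
      = √((n : ℝ) + 1) * weightedForm v a b hv (c n) (c (n + 1))
        + √(n : ℝ) * weightedForm v a b hv (c n) (c (n - 1)) := by
    simp [β]
  have hβM (n : ℕ) : massForm a b (β n) (β n)
      = ((n : ℝ) + 1) * massForm a b (c (n + 1)) (c (n + 1))
        + (n : ℝ) * massForm a b (c (n - 1)) (c (n - 1))
        + 2 * √((n : ℝ) * ((n : ℝ) + 1)) * massForm a b (c (n - 1)) (c (n + 1)) := by
    have h1 : √((n : ℝ) + 1) * √((n : ℝ) + 1) = (n : ℝ) + 1 := mul_self_sqrt (by positivity)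
    have h2 : √(n : ℝ) * √(n : ℝ) = (n : ℝ) := mul_self_sqrt (by positivity)
    rw [sqrt_mul (by positivity)]
    simp only [β, map_add, map_smul, LinearMap.add_apply, LinearMap.smul_apply, smul_eq_mul]
    rw [massForm_comm a b (c (n + 1)) (c (n - 1))]
    linear_combination massForm a b (c (n + 1)) (c (n + 1)) * h1
      + massForm a b (c (n - 1)) (c (n - 1)) * h2
  simp only [← hβW, hc, map_zero, mul_zero, add_zero] at hW
  simp only [← hβM, hc, map_zero, mul_zero, add_zero] at hM
  have hβsum : ∑ n ∈ Finset.range N, massForm a b (β n) (β n)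
      ≤ 2 * ∑ n ∈ Finset.range N, (((n : ℝ) + 1 / 2) * massForm a b (c n) (c n)
          + √(((n : ℝ) - 1) * (n : ℝ)) * massForm a b (c (n - 2)) (c n)) := by
    have hnonneg := mul_nonneg (Nat.cast_nonneg (α := ℝ) N)
      (massForm_self_nonneg hab (c ((N : ℤ) - 1)))
    rw [hM, Finset.mul_sum]
    refine (sub_le_self _ hnonneg).trans (Finset.sum_le_sum fun n _ => le_of_eq (by ring))
  have hyoung := Finset.sum_le_sum fun n (_ : n ∈ Finset.range N) =>
    weightedForm_le_massForm hab hv hve (s := s) hγ (c n) (β n)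
  rw [← Finset.mul_sum, hW, Finset.sum_add_distrib, ← Finset.mul_sum, ← Finset.mul_sum] at hyoung
  have hmass : 0 ≤ 1 / (2 * γ) * ∑ n ∈ Finset.range N, massForm a b (c n) (c n) :=
    mul_nonneg (by positivity) (Finset.sum_nonneg fun n _ => massForm_self_nonneg hab _)
  have hcoef : 0 ≤ γ / 2 * e ^ 2 * s ^ 2 := by positivity
  linarith [mul_le_mul_of_nonneg_left hβsum hcoef]

/-- The dissipative weighted L² estimate for the semi-discrete DG/Hermite scheme:
`(1/2) d/dt Σₙ α ∫₀ᴸ C_{n,h}² dx + (α/2) Σₙ Σⱼ δₙ [C_{n,h}]²_{j-1/2} ≤ (1/(2γ)) Σₙ α ∫₀ᴸ C_{n,h}² dx`. -/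
theorem dg_hermite_dissipative_estimate
    (N_H k N_x : ℕ) (hNH : 3 ≤ N_H) (hNx : 1 ≤ N_x)
    (L α₀ γ : ℝ) (hL : 0 < L) (hα₀ : 0 < α₀) (hγ : 0 < γ)
    -- the mesh 0 = x_{1/2} < x_{3/2} < ⋯ < x_{N_x+1/2} = L; `X j` is the node x_{j+1/2}
    (X : ℕ → ℝ) (hX0 : X 0 = 0) (hXL : X N_x = L)
    (hXmono : ∀ j, j < N_x → X j < X (j + 1))
    -- the piecewise-polynomial coefficients: `C n t j` is the polynomial of degree ≤ k
    -- representing C_{n,h}(t,·) on the cell I_j = [X (j-1), X j], j = 1, …, N_x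
    (C : ℤ → ℝ → ℕ → Polynomial ℝ)
    (hdeg : ∀ (n : ℤ) (t : ℝ) (j : ℕ), (C n t j).natDegree ≤ k)
    (hCneg : ∀ n : ℤ, n < 0 → ∀ (t : ℝ) (j : ℕ), C n t j = 0)
    (hCbig : ∀ n : ℤ, (N_H : ℤ) ≤ n → ∀ (t : ℝ) (j : ℕ), C n t j = 0)
    (hCdiff : ∀ (n : ℤ) (j : ℕ) (x : ℝ), Differentiable ℝ (fun t => (C n t j).eval x))
    -- the electric field, bounded on [0,L], with continuous sup norm `Einf`
    (Eh : ℝ → ℝ → ℝ) (Einf : ℝ → ℝ)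
    (hEinf : ∀ t, Einf t = sSup {y | ∃ x ∈ Set.Icc (0:ℝ) L, y = |Eh t x|})
    (hEbdd : ∀ t, BddAbove {y | ∃ x ∈ Set.Icc (0:ℝ) L, y = |Eh t x|})
    (hEcont : Continuous Einf)
    -- the scaling function α and its derivative α' = -(γ/2) ‖E_h‖_∞² α³
    (α αd : ℝ → ℝ)
    (hα : ∀ t, α t = α₀ / Real.sqrt (1 + γ * ∫ s in (0:ℝ)..t, (Einf s) ^ 2))
    (hαd : ∀ t, αd t = -(γ / 2) * (Einf t) ^ 2 * (α t) ^ 3)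
    (hαderiv : ∀ t, 0 ≤ t → HasDerivAt α (αd t) t)
    -- traces: `Cm n t j` (resp. `Cp n t j`) is the left (resp. right) one-sided value
    -- of C_{n,h}(t,·) at the node x_{j-1/2}, with periodic identification
    (Cm Cp : ℤ → ℝ → ℕ → ℝ)
    (hCm : ∀ (n : ℤ) (t : ℝ) (j : ℕ),
      Cm n t j = (C n t (if j = 1 then N_x else j - 1)).eval (if j = 1 then X N_x else X (j - 1)))
    (hCp : ∀ (n : ℤ) (t : ℝ) (j : ℕ), Cp n t j = (C n t j).eval (X (j - 1)))
    -- the numerical viscosity δₙ : δ₀ = 0 and δₙ = √(N_H)/α for 1 ≤ n ≤ N_H - 1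
    (δ : ℤ → ℝ → ℝ)
    (hδ : ∀ (n : ℤ) (t : ℝ), δ n t = if n = 0 then 0 else Real.sqrt (N_H : ℝ) / α t)
    -- the numerical flux ĝₙ = (1/2)(gₙ⁻ + gₙ⁺ - δₙ (Cₙ⁺ - Cₙ⁻)) at the node x_{j-1/2}
    (ghat : ℤ → ℝ → ℕ → ℝ)
    (hghat : ∀ (n : ℤ) (t : ℝ) (j : ℕ),
      ghat n t j = (1 / 2) *
        ((1 / α t) * (Real.sqrt ((n : ℝ) + 1) * Cm (n + 1) t j + Real.sqrt (n : ℝ) * Cm (n - 1) t j)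
          + (1 / α t) * (Real.sqrt ((n : ℝ) + 1) * Cp (n + 1) t j + Real.sqrt (n : ℝ) * Cp (n - 1) t j)
          - δ n t * (Cp n t j - Cm n t j)))
    -- the semi-discrete DG scheme: for every cell j and test polynomial φ of degree ≤ k
    (hDG : ∀ n : ℤ, 0 ≤ n → n < (N_H : ℤ) → ∀ j ∈ Finset.Icc 1 N_x, ∀ t : ℝ, 0 ≤ t →
      ∀ φ : Polynomial ℝ, φ.natDegree ≤ k →
      HasDerivAt (fun τ => ∫ x in X (j - 1)..X j, (C n τ j).eval x * φ.eval x)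
        ((αd t / α t) * (∫ x in X (j - 1)..X j,
            ((n : ℝ) * (C n t j).eval x
              + Real.sqrt (((n : ℝ) - 1) * (n : ℝ)) * (C (n - 2) t j).eval x) * φ.eval x)
          - (-(∫ x in X (j - 1)..X j,
                (1 / α t) * (Real.sqrt ((n : ℝ) + 1) * (C (n + 1) t j).eval x
                  + Real.sqrt (n : ℝ) * (C (n - 1) t j).eval x)
                  * (Polynomial.derivative φ).eval x)
              + ghat n t (if j = N_x then 1 else j + 1) * φ.eval (X j)
              - ghat n t j * φ.eval (X (j - 1)))
          + α t * Real.sqrt (n : ℝ) *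
            ∫ x in X (j - 1)..X j, Eh t x * (C (n - 1) t j).eval x * φ.eval x) t) :
    ∀ t, 0 ≤ t → ∀ D : ℝ,
      HasDerivAt
        (fun τ => ∑ n ∈ Finset.range N_H,
          α τ * ∑ j ∈ Finset.Icc 1 N_x, ∫ x in X (j - 1)..X j, ((C n τ j).eval x) ^ 2) D t →
      (1 / 2) * D
        + (α t / 2) * ∑ n ∈ Finset.Icc 1 (N_H - 1), ∑ j ∈ Finset.Icc 1 N_x,
            δ n t * (Cp n t j - Cm n t j) ^ 2
        ≤ (1 / (2 * γ)) * ∑ n ∈ Finset.range N_H,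
            α t * ∑ j ∈ Finset.Icc 1 N_x, ∫ x in X (j - 1)..X j, ((C n t j).eval x) ^ 2 := by
  intro t ht D hD
  have hcell : ∀ j ∈ Finset.Icc 1 N_x, X (j - 1) ≤ X j := by
    intro j hj
    obtain ⟨hj1, hjN⟩ := Finset.mem_Icc.1 hj
    have h := hXmono (j - 1) (by omega)
    rw [Nat.sub_add_cancel hj1] at h
    exact h.le
  have hXmonoOn : MonotoneOn X (Set.Icc 0 N_x) := by
    refine monotoneOn_of_le_add_one Set.ordConnected_Icc fun j _ _ hj => ?_
    exact (hXmono j (Nat.lt_of_succ_le hj.2)).le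
  have hfield : ∀ j ∈ Finset.Icc 1 N_x, ∀ x ∈ Set.Icc (X (j - 1)) (X j), |Eh t x| ≤ Einf t := by
    intro j hj x hx
    obtain ⟨hj1, hjN⟩ := Finset.mem_Icc.1 hj
    have hlow : X 0 ≤ X (j - 1) :=
      hXmonoOn (by simp) (by simp; omega) (Nat.zero_le _)
    have hupp : X j ≤ X N_x := hXmonoOn (by simpa using hjN) (by simp) hjN
    rw [hEinf]
    exact le_csSup (hEbdd t) ⟨x, ⟨by linarith [hx.1], by linarith [hx.2]⟩, rfl⟩
  have hEnonneg : 0 ≤ Einf t := by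
    rw [hEinf]
    refine Real.sSup_nonneg ?_
    rintro _ ⟨x, _, rfl⟩
    exact abs_nonneg _
  have hαpos : 0 < α t := by
    have hint : 0 ≤ ∫ s in (0 : ℝ)..t, (Einf s) ^ 2 :=
      intervalIntegral.integral_nonneg ht fun _ _ => sq_nonneg _
    rw [hα]
    positivity
  have hCm' (n : ℤ) (j : ℕ) :
      Cm n t j = (C n t (prevCell N_x j)).eval (X (prevCell N_x j)) := by
    rw [hCm, prevCell]
    split_ifs <;> rfl
  let m (n j : ℕ) : ℝ := massForm (X (j - 1)) (X j) (C n t j) (C n t j)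
  let q (n j : ℕ) : ℝ := (n : ℝ) * m n j
    + √(((n : ℝ) - 1) * n) * massForm (X (j - 1)) (X j) (C (n - 2) t j) (C n t j)
  let T (n j : ℕ) : ℝ :=
    -(∫ x in X (j - 1)..X j, 1 / α t * (√((n : ℝ) + 1) * (C (n + 1) t j).eval x
          + √(n : ℝ) * (C (n - 1) t j).eval x) * (Polynomial.derivative (C n t j)).eval x)
      + ghat n t (if j = N_x then 1 else j + 1) * (C n t j).eval (X j)
      - ghat n t j * (C n t j).eval (X (j - 1))
  let w (n j : ℕ) : ℝ :=
    √(n : ℝ) * ∫ x in X (j - 1)..X j, Eh t x * (C (n - 1) t j).eval x * (C n t j).eval x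
  let R (n j : ℕ) : ℝ := αd t / α t * q n j - T n j + α t * w n j
  have hmass (n : ℕ) (τ : ℝ) (j : ℕ) : ∫ x in X (j - 1)..X j, ((C n τ j).eval x) ^ 2
      = massForm (X (j - 1)) (X j) (C n τ j) (C n τ j) := by
    simp only [massForm_apply, sq]
  have hderiv : ∀ n ∈ Finset.range N_H, ∀ j ∈ Finset.Icc 1 N_x,
      HasDerivAt (fun τ => massForm (X (j - 1)) (X j) (C n τ j) (C n τ j)) (2 * R n j) t := by
    intro n hn j hj
    refine hasDerivAt_bilin_self (fun τ => hdeg n τ j) (hCdiff n j) _ (massForm_comm _ _) ?_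
    have h := hDG n (by positivity) (by exact_mod_cast Finset.mem_range.1 hn) j hj t ht
      (C n t j) (hdeg n t j)
    simp only [Int.cast_natCast] at h
    simp only [massForm_apply (X (j - 1)) (X j) (C n _ j) (C n t j)]
    convert h using 1
    have hlin := massForm_apply (X (j - 1)) (X j)
      ((n : ℝ) • C n t j + √(((n : ℝ) - 1) * n) • C (n - 2) t j) (C n t j)
    simp only [map_add, map_smul, LinearMap.add_apply, LinearMap.smul_apply, smul_eq_mul,
      Polynomial.eval_add, Polynomial.eval_smul] at hlin
    simp only [R, q, m, T, w]
    rw [hlin]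
    ring
  have hDeq : D = ∑ n ∈ Finset.range N_H,
      (αd t * ∑ j ∈ Finset.Icc 1 N_x, m n j + α t * ∑ j ∈ Finset.Icc 1 N_x, 2 * R n j) := by
    refine hD.unique ?_
    simp only [hmass]
    exact HasDerivAt.fun_sum fun n hn => (hαderiv t ht).mul
      (HasDerivAt.fun_sum fun j hj => hderiv n hn j hj)
  have htransport : ∑ n ∈ Finset.range N_H, ∑ j ∈ Finset.Icc 1 N_x, T n j
      = 1 / 2 * ∑ n ∈ Finset.Icc 1 (N_H - 1), ∑ j ∈ Finset.Icc 1 N_x,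
          δ n t * (Cp n t j - Cm n t j) ^ 2 := by
    have hn (n : ℕ) := sum_dg_transport X N_x (1 / α t) (√((n : ℝ) + 1)) (√(n : ℝ)) (δ n t)
      (C (n + 1) t) (C (n - 1) t) (C n t) (ghat n t)
      (fun j => by rw [hghat]; simp only [hCm', hCp, Int.cast_natCast])
    have hcentral := sum_hermite_antisymm (fun m n => centralForm X N_x (C m t) (C n t))
      (fun m n => centralForm_antisymm _ _ _ _) N_H
    have htop : C (N_H : ℤ) t = 0 := funext fun j => hCbig N_H le_rfl t j
    simp only [htop, centralForm_zero_left, mul_zero] at hcentral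
    simp only [T, hn]
    rw [Finset.sum_add_distrib, ← Finset.mul_sum, hcentral, mul_zero, zero_add, ← Finset.mul_sum]
    congr 1
    obtain ⟨M, rfl⟩ : ∃ M, N_H = M + 1 := ⟨N_H - 1, by omega⟩
    rw [Finset.range_eq_Ico, Finset.sum_eq_sum_Ico_succ_bot (Nat.succ_pos M), hδ]
    simp only [hCm', hCp, Nat.cast_zero, if_true, zero_mul, Finset.sum_const_zero, zero_add]
    rfl
  have hfield_le : ∑ j ∈ Finset.Icc 1 N_x, α t * ∑ n ∈ Finset.range N_H, w n j
      ≤ ∑ j ∈ Finset.Icc 1 N_x,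
        (γ / 2 * Einf t ^ 2 * α t ^ 2 * ∑ n ∈ Finset.range N_H, (q n j + 1 / 2 * m n j)
          + 1 / (2 * γ) * ∑ n ∈ Finset.range N_H, m n j) := by
    refine Finset.sum_le_sum fun j hj => ?_
    have hq (n : ℕ) : q n j + 1 / 2 * m n j = ((n : ℝ) + 1 / 2) * m n j
        + √(((n : ℝ) - 1) * n) * massForm (X (j - 1)) (X j) (C (n - 2) t j) (C n t j) := by
      simp only [q]
      ring
    simp only [hq]
    exact hermite_field_le (hcell j hj) hEnonneg (hfield j hj) (s := α t) hγ N_H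
      (fun n => C n t j) (hCbig N_H le_rfl t j)
  simp only [hmass]
  change _ ≤ 1 / (2 * γ) * ∑ n ∈ Finset.range N_H, α t * ∑ j ∈ Finset.Icc 1 N_x, m n j
  have hratio : αd t / α t = -(γ / 2 * Einf t ^ 2 * α t ^ 2) := by
    rw [hαd]
    field_simp
  simp only [R, hratio] at hDeq
  simp only [Finset.sum_add_distrib, Finset.sum_sub_distrib, ← Finset.mul_sum] at hDeq hfield_le
  rw [htransport] at hDeq
  simp only [Finset.sum_comm (s := Finset.Icc 1 N_x) (t := Finset.range N_H)] at hfield_le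
  rw [hDeq, ← Finset.mul_sum, hαd]
  linear_combination α t * hfield_le
end

section
/- For the semi-discrete discontinuous Galerkin / Hermite scheme coupled with the local discontinuous Galerkin discretization of the Poisson equation, the discrete total energy is conserved: the function t ↦ (1/2) ∫₀ᴸ [ α(t)^{−2}(√2 C_{2,h}(t,x) + C_{0,h}(t,x)) + E_h(t,x)² ] dx + (β/2) Σ_{j=1}^{N_x} [Φ_h]²_{j−1/2}(t) is constant on [0,∞). -/
open MeasureTheory Real

/-- The `L²` pairing of two real polynomials on the interval `[a, b]`. -/
noncomputable def polyPairing (a b : ℝ) : Polynomial ℝ →ₗ[ℝ] Polynomial ℝ →ₗ[ℝ] ℝ :=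
  LinearMap.mk₂ ℝ (fun p q => ∫ x in a..b, p.eval x * q.eval x)
    (fun p q r => by
      simp only [Polynomial.eval_add, add_mul]
      exact intervalIntegral.integral_add (by apply Continuous.intervalIntegrable; fun_prop)
        (by apply Continuous.intervalIntegrable; fun_prop))
    (fun c p q => by
      simp only [Polynomial.eval_smul, smul_eq_mul, mul_assoc]
      exact intervalIntegral.integral_const_mul _ _)
    (fun p q r => by
      simp only [Polynomial.eval_add, mul_add]
      exact intervalIntegral.integral_add (by apply Continuous.intervalIntegrable; fun_prop)
        (by apply Continuous.intervalIntegrable; fun_prop))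
    (fun c p q => by
      simp only [Polynomial.eval_smul, smul_eq_mul, mul_left_comm _ c]
      exact intervalIntegral.integral_const_mul _ _)

theorem polyPairing_apply (a b : ℝ) (p q : Polynomial ℝ) :
    polyPairing a b p q = ∫ x in a..b, p.eval x * q.eval x := rfl

theorem polyPairing_comm (a b : ℝ) (p q : Polynomial ℝ) :
    polyPairing a b p q = polyPairing a b q p := by
  simp only [polyPairing_apply, mul_comm]

theorem polyPairing_derivative_add (a b : ℝ) (p q : Polynomial ℝ) :
    polyPairing a b (Polynomial.derivative p) q + polyPairing a b p (Polynomial.derivative q)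
      = p.eval b * q.eval b - p.eval a * q.eval a := by
  rw [polyPairing_apply, polyPairing_apply, ← intervalIntegral.integral_add
    (by apply Continuous.intervalIntegrable; fun_prop)
    (by apply Continuous.intervalIntegrable; fun_prop)]
  exact intervalIntegral.integral_deriv_mul_eq_sub (fun x _ => p.hasDerivAt x)
    (fun x _ => q.hasDerivAt x) (by apply Continuous.intervalIntegrable; fun_prop)
    (by apply Continuous.intervalIntegrable; fun_prop)

/-- A pointwise differentiable curve of polynomials of bounded degree is differentiable
against every linear functional. -/
theorem exists_polynomial_hasDerivAt {k : ℕ} {p : ℝ → Polynomial ℝ}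
    (hdeg : ∀ t, (p t).natDegree ≤ k)
    (hp : ∀ x, Differentiable ℝ (fun t => (p t).eval x)) (t : ℝ) :
    ∃ p' : Polynomial ℝ, p'.natDegree ≤ k ∧
      ∀ f : Polynomial ℝ →ₗ[ℝ] ℝ, HasDerivAt (fun τ => f (p τ)) (f p') t := by
  have hinj : Set.InjOn (fun i : ℕ => (i : ℝ)) (Finset.range (k + 1) : Finset ℕ) :=
    Nat.cast_injective.injOn
  have hrep : ∀ τ, p τ = ∑ i ∈ Finset.range (k + 1),
      (p τ).eval (i : ℝ) • Lagrange.basis (Finset.range (k + 1)) (fun i : ℕ => (i : ℝ)) i := by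
    intro τ
    have hlt : (p τ).degree < (Finset.range (k + 1)).card := by
      rw [Finset.card_range]
      exact lt_of_le_of_lt Polynomial.degree_le_natDegree
        (by exact_mod_cast Nat.lt_succ_of_le (hdeg τ))
    conv_lhs => rw [Lagrange.eq_interpolate hinj hlt, Lagrange.interpolate_apply]
    simp only [Polynomial.smul_eq_C_mul]
  refine ⟨∑ i ∈ Finset.range (k + 1), deriv (fun τ => (p τ).eval (i : ℝ)) t •
      Lagrange.basis (Finset.range (k + 1)) (fun i : ℕ => (i : ℝ)) i, ?_, fun f => ?_⟩
  · refine Polynomial.natDegree_sum_le_of_forall_le _ _ fun i hi => ?_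
    refine (Polynomial.natDegree_smul_le _ _).trans ?_
    rw [Polynomial.natDegree_le_iff_degree_le, Lagrange.degree_basis hinj hi, Finset.card_range]
    simp
  · have heq : (fun τ => f (p τ)) = fun τ => ∑ i ∈ Finset.range (k + 1),
        (p τ).eval (i : ℝ) *
          f (Lagrange.basis (Finset.range (k + 1)) (fun i : ℕ => (i : ℝ)) i) := by
      funext τ
      conv_lhs => rw [hrep τ]
      simp only [map_sum, map_smul, smul_eq_mul]
    rw [heq]
    simp only [map_sum, map_smul, smul_eq_mul]
    exact HasDerivAt.fun_sum fun i _ => ((hp i t).hasDerivAt).mul_const _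

theorem hasDerivAt_bilinear_polynomial {k : ℕ} {p q : ℝ → Polynomial ℝ} {p' q' : Polynomial ℝ}
    {t : ℝ} (hdeg : ∀ t, (p t).natDegree ≤ k) (hdeg' : p'.natDegree ≤ k)
    (hp : ∀ f : Polynomial ℝ →ₗ[ℝ] ℝ, HasDerivAt (fun τ => f (p τ)) (f p') t)
    (hq : ∀ f : Polynomial ℝ →ₗ[ℝ] ℝ, HasDerivAt (fun τ => f (q τ)) (f q') t)
    (B : Polynomial ℝ →ₗ[ℝ] Polynomial ℝ →ₗ[ℝ] ℝ) :
    HasDerivAt (fun τ => B (p τ) (q τ)) (B p' (q t) + B (p t) q') t := by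
  have hrep : ∀ r s : Polynomial ℝ, r.natDegree ≤ k → B r s = ∑ i ∈ Finset.range (k + 1),
      Polynomial.lcoeff ℝ i r * B (Polynomial.X ^ i) s := by
    intro r s hr
    conv_lhs => rw [r.as_sum_range_C_mul_X_pow' (Nat.lt_succ_of_le hr)]
    simp [← Polynomial.smul_eq_C_mul]
  have heq : (fun τ => B (p τ) (q τ)) = fun τ => ∑ i ∈ Finset.range (k + 1),
      Polynomial.lcoeff ℝ i (p τ) * B (Polynomial.X ^ i) (q τ) :=
    funext fun τ => hrep _ _ (hdeg τ)
  rw [heq, hrep p' _ hdeg', hrep (p t) _ (hdeg t), ← Finset.sum_add_distrib]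
  exact HasDerivAt.fun_sum fun i _ => (hp _).mul (hq _)

theorem sum_Icc_cyclic_shift {M : Type*} [AddCommMonoid M] (N : ℕ) (f : ℕ → ℕ → M) :
    ∑ j ∈ Finset.Icc 1 N, f (if j = N then 1 else j + 1) j
      = ∑ j ∈ Finset.Icc 1 N, f j (if j = 1 then N else j - 1) := by
  refine Finset.sum_bij' (fun j _ => if j = N then 1 else j + 1)
    (fun j _ => if j = 1 then N else j - 1) ?_ ?_ ?_ ?_ ?_
  all_goals intro j hj; rw [Finset.mem_Icc] at hj
  · rw [Finset.mem_Icc]; split_ifs <;> omega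
  · rw [Finset.mem_Icc]; split_ifs <;> omega
  · split_ifs <;> omega
  · split_ifs <;> omega
  · congr 1; split_ifs <;> omega

/-- The left trace `u⁻` at the node `X (j - 1)` of a periodic piecewise polynomial on `N` cells. -/
noncomputable def leftTrace (N : ℕ) (X : ℕ → ℝ) (u : ℕ → Polynomial ℝ) (j : ℕ) : ℝ :=
  (u (if j = 1 then N else j - 1)).eval (if j = 1 then X N else X (j - 1))

/-- The right trace `u⁺` at the node `X (j - 1)` of a piecewise polynomial. -/
noncomputable def rightTrace (X : ℕ → ℝ) (u : ℕ → Polynomial ℝ) (j : ℕ) : ℝ :=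
  (u j).eval (X (j - 1))

theorem sum_cell_flux (N : ℕ) (X : ℕ → ℝ) (F : ℕ → ℝ) (u : ℕ → Polynomial ℝ) :
    ∑ j ∈ Finset.Icc 1 N, (F (if j = N then 1 else j + 1) * (u j).eval (X j)
        - F j * (u j).eval (X (j - 1)))
      = -∑ j ∈ Finset.Icc 1 N, F j * (rightTrace X u j - leftTrace N X u j) := by
  rw [Finset.sum_sub_distrib, sum_Icc_cyclic_shift N fun a b => F a * (u b).eval (X b),
    ← Finset.sum_sub_distrib, ← Finset.sum_neg_distrib]
  refine Finset.sum_congr rfl fun j _ => ?_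
  simp only [rightTrace, leftTrace, apply_ite X]
  ring

theorem sum_cell_boundary_mul (N : ℕ) (X : ℕ → ℝ) (u v : ℕ → Polynomial ℝ) :
    ∑ j ∈ Finset.Icc 1 N, ((u j).eval (X j) * (v j).eval (X j)
        - (u j).eval (X (j - 1)) * (v j).eval (X (j - 1)))
      = -∑ j ∈ Finset.Icc 1 N, (rightTrace X u j * rightTrace X v j
          - leftTrace N X u j * leftTrace N X v j) := by
  rw [Finset.sum_sub_distrib, sum_Icc_cyclic_shift N fun _ b => (u b).eval (X b) * (v b).eval (X b),
    ← Finset.sum_sub_distrib, ← Finset.sum_neg_distrib]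
  refine Finset.sum_congr rfl fun j _ => ?_
  simp only [rightTrace, leftTrace, apply_ite X]
  ring

/-- Integration by parts over all cells, with averages and jumps at the nodes. -/
theorem sum_polyPairing_derivative (N : ℕ) (X : ℕ → ℝ) (u v : ℕ → Polynomial ℝ) :
    ∑ j ∈ Finset.Icc 1 N, polyPairing (X (j - 1)) (X j) (Polynomial.derivative (u j)) (v j)
      = -(∑ j ∈ Finset.Icc 1 N,
            polyPairing (X (j - 1)) (X j) (u j) (Polynomial.derivative (v j)))
        - ∑ j ∈ Finset.Icc 1 N, (rightTrace X u j + leftTrace N X u j) / 2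
            * (rightTrace X v j - leftTrace N X v j)
        - ∑ j ∈ Finset.Icc 1 N, (rightTrace X v j + leftTrace N X v j) / 2
            * (rightTrace X u j - leftTrace N X u j) := by
  have hparts := Finset.sum_congr (rfl : Finset.Icc 1 N = _)
    fun j _ => polyPairing_derivative_add (X (j - 1)) (X j) (u j) (v j)
  rw [sum_cell_boundary_mul, Finset.sum_add_distrib] at hparts
  have hjump : ∑ j ∈ Finset.Icc 1 N, (rightTrace X u j * rightTrace X v j
          - leftTrace N X u j * leftTrace N X v j)
      = ∑ j ∈ Finset.Icc 1 N, (rightTrace X u j + leftTrace N X u j) / 2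
            * (rightTrace X v j - leftTrace N X v j)
        + ∑ j ∈ Finset.Icc 1 N, (rightTrace X v j + leftTrace N X v j) / 2
            * (rightTrace X u j - leftTrace N X u j) := by
    rw [← Finset.sum_add_distrib]
    exact Finset.sum_congr rfl fun j _ => by ring
  linarith

/-- Conservation of the discrete total energy for the semi-discrete DG/Hermite
scheme coupled with the local discontinuous Galerkin Poisson solver. -/
theorem dg_hermite_ldg_energy_conservation
    (N_H k N_x : ℕ) (hNH : 3 ≤ N_H) (hNx : 1 ≤ N_x)
    (L α₀ γ ρ₀ β : ℝ) (hL : 0 < L) (hα₀ : 0 < α₀) (hγ : 0 < γ) (hβ : 0 < β)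
    -- the mesh 0 = x_{1/2} < x_{3/2} < ⋯ < x_{N_x+1/2} = L; `X j` is the node x_{j+1/2}
    (X : ℕ → ℝ) (hX0 : X 0 = 0) (hXL : X N_x = L)
    (hXmono : ∀ j, j < N_x → X j < X (j + 1))
    -- the piecewise-polynomial coefficients: `C n t j` is the polynomial of degree ≤ k
    -- representing C_{n,h}(t,·) on the cell I_j = [X (j-1), X j], j = 1, …, N_x
    (C : ℤ → ℝ → ℕ → Polynomial ℝ)
    (hdeg : ∀ (n : ℤ) (t : ℝ) (j : ℕ), (C n t j).natDegree ≤ k)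
    (hCneg : ∀ n : ℤ, n < 0 → ∀ (t : ℝ) (j : ℕ), C n t j = 0)
    (hCbig : ∀ n : ℤ, (N_H : ℤ) ≤ n → ∀ (t : ℝ) (j : ℕ), C n t j = 0)
    (hCdiff : ∀ (n : ℤ) (j : ℕ) (x : ℝ), Differentiable ℝ (fun t => (C n t j).eval x))
    -- the piecewise-polynomial potential Φ_h and electric field E_h, in V_h^k,
    -- depending differentiably on t
    (Φh Eh : ℝ → ℕ → Polynomial ℝ)
    (hΦdeg : ∀ (t : ℝ) (j : ℕ), (Φh t j).natDegree ≤ k)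
    (hEdeg : ∀ (t : ℝ) (j : ℕ), (Eh t j).natDegree ≤ k)
    (hΦdiff : ∀ (j : ℕ) (x : ℝ), Differentiable ℝ (fun t => (Φh t j).eval x))
    (hEdiff : ∀ (j : ℕ) (x : ℝ), Differentiable ℝ (fun t => (Eh t j).eval x))
    -- the sup norm of E_h on [0,L], assumed continuous in t
    (Einf : ℝ → ℝ)
    (hEinf : ∀ t, Einf t =
      sSup {y | ∃ j ∈ Finset.Icc 1 N_x, ∃ x ∈ Set.Icc (X (j - 1)) (X j), y = |(Eh t j).eval x|})
    (hEcont : Continuous Einf)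
    -- the scaling function α and its derivative α' = -(γ/2) ‖E_h‖_∞² α³
    (α αd : ℝ → ℝ)
    (hα : ∀ t, α t = α₀ / Real.sqrt (1 + γ * ∫ s in (0:ℝ)..t, (Einf s) ^ 2))
    (hαd : ∀ t, αd t = -(γ / 2) * (Einf t) ^ 2 * (α t) ^ 3)
    (hαderiv : ∀ t, 0 ≤ t → HasDerivAt α (αd t) t)
    -- traces at the node x_{j-1/2} (left value `m`, right value `p`),
    -- with periodic identification of x_{1/2} and x_{N_x+1/2}
    (Cm Cp : ℤ → ℝ → ℕ → ℝ) (Φm Φp Em Ep : ℝ → ℕ → ℝ)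
    (hCm : ∀ (n : ℤ) (t : ℝ) (j : ℕ),
      Cm n t j = (C n t (if j = 1 then N_x else j - 1)).eval (if j = 1 then X N_x else X (j - 1)))
    (hCp : ∀ (n : ℤ) (t : ℝ) (j : ℕ), Cp n t j = (C n t j).eval (X (j - 1)))
    (hΦm : ∀ (t : ℝ) (j : ℕ),
      Φm t j = (Φh t (if j = 1 then N_x else j - 1)).eval (if j = 1 then X N_x else X (j - 1)))
    (hΦp : ∀ (t : ℝ) (j : ℕ), Φp t j = (Φh t j).eval (X (j - 1)))
    (hEm : ∀ (t : ℝ) (j : ℕ),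
      Em t j = (Eh t (if j = 1 then N_x else j - 1)).eval (if j = 1 then X N_x else X (j - 1)))
    (hEp : ∀ (t : ℝ) (j : ℕ), Ep t j = (Eh t j).eval (X (j - 1)))
    -- the numerical viscosity δₙ : δ₀ = 0 and δₙ = √(N_H)/α for 1 ≤ n ≤ N_H - 1
    (δ : ℤ → ℝ → ℝ)
    (hδ : ∀ (n : ℤ) (t : ℝ), δ n t = if n = 0 then 0 else Real.sqrt (N_H : ℝ) / α t)
    -- the numerical flux ĝₙ = (1/2)(gₙ⁻ + gₙ⁺ - δₙ (Cₙ⁺ - Cₙ⁻)) at the node x_{j-1/2}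
    (ghat : ℤ → ℝ → ℕ → ℝ)
    (hghat : ∀ (n : ℤ) (t : ℝ) (j : ℕ),
      ghat n t j = (1 / 2) *
        ((1 / α t) * (Real.sqrt ((n : ℝ) + 1) * Cm (n + 1) t j + Real.sqrt (n : ℝ) * Cm (n - 1) t j)
          + (1 / α t) * (Real.sqrt ((n : ℝ) + 1) * Cp (n + 1) t j + Real.sqrt (n : ℝ) * Cp (n - 1) t j)
          - δ n t * (Cp n t j - Cm n t j)))
    -- the LDG fluxes Φ̂ = {Φ_h} and Ê = {E_h} - β[Φ_h] at the node x_{j-1/2}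
    (Φhat Ehat : ℝ → ℕ → ℝ)
    (hΦhat : ∀ (t : ℝ) (j : ℕ), Φhat t j = (Φp t j + Φm t j) / 2)
    (hEhat : ∀ (t : ℝ) (j : ℕ),
      Ehat t j = (Ep t j + Em t j) / 2 - β * (Φp t j - Φm t j))
    -- the semi-discrete DG scheme: for every cell j and test polynomial φ of degree ≤ k
    (hDG : ∀ n : ℤ, 0 ≤ n → n < (N_H : ℤ) → ∀ j ∈ Finset.Icc 1 N_x, ∀ t : ℝ, 0 ≤ t →
      ∀ φ : Polynomial ℝ, φ.natDegree ≤ k →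
      HasDerivAt (fun τ => ∫ x in X (j - 1)..X j, (C n τ j).eval x * φ.eval x)
        ((αd t / α t) * (∫ x in X (j - 1)..X j,
            ((n : ℝ) * (C n t j).eval x
              + Real.sqrt (((n : ℝ) - 1) * (n : ℝ)) * (C (n - 2) t j).eval x) * φ.eval x)
          - (-(∫ x in X (j - 1)..X j,
                (1 / α t) * (Real.sqrt ((n : ℝ) + 1) * (C (n + 1) t j).eval x
                  + Real.sqrt (n : ℝ) * (C (n - 1) t j).eval x)
                  * (Polynomial.derivative φ).eval x)
              + ghat n t (if j = N_x then 1 else j + 1) * φ.eval (X j)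
              - ghat n t j * φ.eval (X (j - 1)))
          + α t * Real.sqrt (n : ℝ) *
            ∫ x in X (j - 1)..X j, (Eh t j).eval x * (C (n - 1) t j).eval x * φ.eval x) t)
    -- the LDG approximation of the Poisson equation
    (hLDG1 : ∀ t : ℝ, 0 ≤ t → ∀ j ∈ Finset.Icc 1 N_x, ∀ η : Polynomial ℝ, η.natDegree ≤ k →
      (∫ x in X (j - 1)..X j, (Φh t j).eval x * (Polynomial.derivative η).eval x)
          - Φhat t (if j = N_x then 1 else j + 1) * η.eval (X j)
          + Φhat t j * η.eval (X (j - 1))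
        = ∫ x in X (j - 1)..X j, (Eh t j).eval x * η.eval x)
    (hLDG2 : ∀ t : ℝ, 0 ≤ t → ∀ j ∈ Finset.Icc 1 N_x, ∀ ζ : Polynomial ℝ, ζ.natDegree ≤ k →
      -(∫ x in X (j - 1)..X j, (Eh t j).eval x * (Polynomial.derivative ζ).eval x)
          + Ehat t (if j = N_x then 1 else j + 1) * ζ.eval (X j)
          - Ehat t j * ζ.eval (X (j - 1))
        = ∫ x in X (j - 1)..X j, ((C 0 t j).eval x - ρ₀) * ζ.eval x) :
    ∀ t, 0 ≤ t →
      (1 / 2) * (∑ j ∈ Finset.Icc 1 N_x, ∫ x in X (j - 1)..X j,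
          ((1 / (α t) ^ 2) * (Real.sqrt 2 * (C 2 t j).eval x + (C 0 t j).eval x)
            + ((Eh t j).eval x) ^ 2))
        + (β / 2) * ∑ j ∈ Finset.Icc 1 N_x, (Φp t j - Φm t j) ^ 2
      = (1 / 2) * (∑ j ∈ Finset.Icc 1 N_x, ∫ x in X (j - 1)..X j,
          ((1 / (α 0) ^ 2) * (Real.sqrt 2 * (C 2 0 j).eval x + (C 0 0 j).eval x)
            + ((Eh 0 j).eval x) ^ 2))
        + (β / 2) * ∑ j ∈ Finset.Icc 1 N_x, (Φp 0 j - Φm 0 j) ^ 2 := by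
  have hα_pos : ∀ t, 0 ≤ t → 0 < α t := by
    intro t ht
    have hint : 0 ≤ ∫ s in (0:ℝ)..t, (Einf s) ^ 2 :=
      intervalIntegral.integral_nonneg ht fun _ _ => sq_nonneg _
    rw [hα]
    positivity
  -- the scheme in terms of the polynomial pairing
  have hC0 : ∀ t, 0 ≤ t → ∀ j ∈ Finset.Icc 1 N_x, ∀ φ : Polynomial ℝ, φ.natDegree ≤ k →
      HasDerivAt (fun τ => polyPairing (X (j - 1)) (X j) (C 0 τ j) φ)
        ((1 / α t) * polyPairing (X (j - 1)) (X j) (C 1 t j) (Polynomial.derivative φ)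
          - (ghat 0 t (if j = N_x then 1 else j + 1) * φ.eval (X j)
            - ghat 0 t j * φ.eval (X (j - 1)))) t := by
    intro t ht j hj φ hφ
    have h := hDG 0 le_rfl (by omega) j hj t ht φ hφ
    simp only [Int.cast_zero, zero_mul, mul_zero, zero_add, add_zero, Real.sqrt_zero,
      Real.sqrt_one, one_mul, intervalIntegral.integral_zero, mul_assoc,
      intervalIntegral.integral_const_mul] at h
    refine h.congr_deriv ?_
    rw [polyPairing_apply]
    ring
  have hC2 : ∀ t, 0 ≤ t → ∀ j ∈ Finset.Icc 1 N_x,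
      HasDerivAt (fun τ => polyPairing (X (j - 1)) (X j) (C 2 τ j) 1)
        ((αd t / α t) * (2 * polyPairing (X (j - 1)) (X j) (C 2 t j) 1
            + Real.sqrt 2 * polyPairing (X (j - 1)) (X j) (C 0 t j) 1)
          - (ghat 2 t (if j = N_x then 1 else j + 1) * (1 : Polynomial ℝ).eval (X j)
            - ghat 2 t j * (1 : Polynomial ℝ).eval (X (j - 1)))
          + α t * Real.sqrt 2 * polyPairing (X (j - 1)) (X j) (Eh t j) (C 1 t j)) t := by
    intro t ht j hj
    have h := hDG 2 (by norm_num) (by omega) j hj t ht 1 (by simp)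
    have hlin : ∫ x in X (j - 1)..X j,
        (2 * (C 2 t j).eval x + Real.sqrt 2 * (C 0 t j).eval x)
        = 2 * (∫ x in X (j - 1)..X j, (C 2 t j).eval x)
          + Real.sqrt 2 * ∫ x in X (j - 1)..X j, (C 0 t j).eval x := by
      rw [intervalIntegral.integral_add (by apply Continuous.intervalIntegrable; fun_prop)
        (by apply Continuous.intervalIntegrable; fun_prop),
        intervalIntegral.integral_const_mul, intervalIntegral.integral_const_mul]
    norm_num [hlin] at h
    simp only [polyPairing_apply, Polynomial.eval_one, mul_one]
    exact h
  -- the total energy in terms of the polynomial pairing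
  set energy : ℝ → ℝ := fun t =>
    (1 / 2) * ((1 / (α t) ^ 2)
        * (Real.sqrt 2 * (∑ j ∈ Finset.Icc 1 N_x, polyPairing (X (j - 1)) (X j) (C 2 t j) 1)
          + ∑ j ∈ Finset.Icc 1 N_x, polyPairing (X (j - 1)) (X j) (C 0 t j) 1)
        + ∑ j ∈ Finset.Icc 1 N_x, polyPairing (X (j - 1)) (X j) (Eh t j) (Eh t j))
      + (β / 2) * ∑ j ∈ Finset.Icc 1 N_x, (Φp t j - Φm t j) ^ 2 with henergy
  have henergy_eq : ∀ t, (1 / 2) * (∑ j ∈ Finset.Icc 1 N_x, ∫ x in X (j - 1)..X j,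
          ((1 / (α t) ^ 2) * (Real.sqrt 2 * (C 2 t j).eval x + (C 0 t j).eval x)
            + ((Eh t j).eval x) ^ 2))
        + (β / 2) * ∑ j ∈ Finset.Icc 1 N_x, (Φp t j - Φm t j) ^ 2 = energy t := by
    intro t
    simp only [henergy]
    congr 2
    rw [Finset.mul_sum, ← Finset.sum_add_distrib, Finset.mul_sum, ← Finset.sum_add_distrib]
    refine Finset.sum_congr rfl fun j _ => ?_
    simp only [polyPairing_apply, Polynomial.eval_one, mul_one, ← sq]
    rw [intervalIntegral.integral_add (by apply Continuous.intervalIntegrable; fun_prop)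
        (by apply Continuous.intervalIntegrable; fun_prop),
      intervalIntegral.integral_const_mul,
      intervalIntegral.integral_add (by apply Continuous.intervalIntegrable; fun_prop)
        (by apply Continuous.intervalIntegrable; fun_prop), intervalIntegral.integral_const_mul]
  suffices hderiv : ∀ t, 0 ≤ t → HasDerivAt energy 0 t by
    intro t ht
    rw [henergy_eq, henergy_eq]
    exact constant_of_has_deriv_right_zero
      (fun s hs => (hderiv s hs.1).continuousAt.continuousWithinAt)
      (fun s hs => (hderiv s hs.1).hasDerivWithinAt) t ⟨ht, le_rfl⟩
  intro t ht
  have hαt : α t ≠ 0 := (hα_pos t ht).ne'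
  choose E' hE'deg hE' using fun j =>
    exists_polynomial_hasDerivAt (fun t => hEdeg t j) (hEdiff j) t
  choose Φ' hΦ'deg hΦ' using fun j =>
    exists_polynomial_hasDerivAt (fun t => hΦdeg t j) (hΦdiff j) t
  have hΦp_eq : ∀ τ j, Φp τ j = rightTrace X (Φh τ) j := hΦp
  have hΦm_eq : ∀ τ j, Φm τ j = leftTrace N_x X (Φh τ) j := hΦm
  have hEp_eq : ∀ τ j, Ep τ j = rightTrace X (Eh τ) j := hEp
  have hEm_eq : ∀ τ j, Em τ j = leftTrace N_x X (Eh τ) j := hEm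
  have hCp_eq : ∀ n τ j, Cp n τ j = rightTrace X (C n τ) j := hCp
  have hCm_eq : ∀ n τ j, Cm n τ j = leftTrace N_x X (C n τ) j := hCm
  have hΦp' : ∀ j, HasDerivAt (fun τ => Φp τ j) (rightTrace X Φ' j) t := fun j => by
    simp only [hΦp]
    exact hΦ' j (Polynomial.leval (X (j - 1)))
  have hΦm' : ∀ j, HasDerivAt (fun τ => Φm τ j) (leftTrace N_x X Φ' j) t := fun j => by
    simp only [hΦm]
    exact hΦ' _ (Polynomial.leval (if j = 1 then X N_x else X (j - 1)))
  have hEp' : ∀ j, HasDerivAt (fun τ => Ep τ j) (rightTrace X E' j) t := fun j => by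
    simp only [hEp]
    exact hE' j (Polynomial.leval (X (j - 1)))
  have hEm' : ∀ j, HasDerivAt (fun τ => Em τ j) (leftTrace N_x X E' j) t := fun j => by
    simp only [hEm]
    exact hE' _ (Polynomial.leval (if j = 1 then X N_x else X (j - 1)))
  set Ehat' : ℕ → ℝ := fun j => (rightTrace X E' j + leftTrace N_x X E' j) / 2
    - β * (rightTrace X Φ' j - leftTrace N_x X Φ' j) with hEhat'_def
  have hEhat' : ∀ j, HasDerivAt (fun τ => Ehat τ j) (Ehat' j) t := fun j => by
    simp only [hEhat]
    exact (((hEp' j).add (hEm' j)).div_const 2).sub (((hΦp' j).sub (hΦm' j)).const_mul β)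
  have hghat0 : ∀ j, ghat 0 t j
      = (1 / α t) * ((rightTrace X (C 1 t) j + leftTrace N_x X (C 1 t) j) / 2) := by
    intro j
    rw [hghat, hδ]
    simp only [hCp_eq, hCm_eq, if_true, Int.cast_zero, Real.sqrt_zero, zero_add, Real.sqrt_one]
    ring
  have hghat_sum : ∀ n, ∑ j ∈ Finset.Icc 1 N_x,
      (ghat n t (if j = N_x then 1 else j + 1) * (1 : Polynomial ℝ).eval (X j)
        - ghat n t j * (1 : Polynomial ℝ).eval (X (j - 1))) = 0 := by
    intro n
    rw [sum_cell_flux N_x X (ghat n t) fun _ => 1]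
    simp [rightTrace, leftTrace]
  have hK0 : HasDerivAt (fun τ => ∑ j ∈ Finset.Icc 1 N_x,
      polyPairing (X (j - 1)) (X j) (C 0 τ j) 1) 0 t := by
    refine (HasDerivAt.fun_sum fun j hj => hC0 t ht j hj 1 (by simp)).congr_deriv ?_
    rw [Finset.sum_sub_distrib, hghat_sum]
    simp
  have hK2 : HasDerivAt (fun τ => ∑ j ∈ Finset.Icc 1 N_x,
      polyPairing (X (j - 1)) (X j) (C 2 τ j) 1)
      ((αd t / α t) * (2 * (∑ j ∈ Finset.Icc 1 N_x, polyPairing (X (j - 1)) (X j) (C 2 t j) 1)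
          + Real.sqrt 2 * ∑ j ∈ Finset.Icc 1 N_x, polyPairing (X (j - 1)) (X j) (C 0 t j) 1)
        + α t * Real.sqrt 2
          * ∑ j ∈ Finset.Icc 1 N_x, polyPairing (X (j - 1)) (X j) (Eh t j) (C 1 t j)) t := by
    refine (HasDerivAt.fun_sum fun j hj => hC2 t ht j hj).congr_deriv ?_
    rw [Finset.sum_add_distrib, Finset.sum_sub_distrib, hghat_sum, ← Finset.mul_sum,
      ← Finset.mul_sum, Finset.sum_add_distrib, ← Finset.mul_sum, ← Finset.mul_sum, sub_zero]
  have hEE : HasDerivAt (fun τ => ∑ j ∈ Finset.Icc 1 N_x,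
      polyPairing (X (j - 1)) (X j) (Eh τ j) (Eh τ j))
      (2 * ∑ j ∈ Finset.Icc 1 N_x, polyPairing (X (j - 1)) (X j) (Eh t j) (E' j)) t := by
    refine (HasDerivAt.fun_sum fun j _ => hasDerivAt_bilinear_polynomial
      (fun τ => hEdeg τ j) (hE'deg j) (hE' j) (hE' j) _).congr_deriv ?_
    rw [Finset.mul_sum]
    exact Finset.sum_congr rfl fun j _ => by rw [polyPairing_comm _ _ (E' j)]; ring
  have hJump : HasDerivAt (fun τ => ∑ j ∈ Finset.Icc 1 N_x, (Φp τ j - Φm τ j) ^ 2)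
      (2 * ∑ j ∈ Finset.Icc 1 N_x, (rightTrace X Φ' j - leftTrace N_x X Φ' j)
        * (rightTrace X (Φh t) j - leftTrace N_x X (Φh t) j)) t := by
    refine (HasDerivAt.fun_sum fun j _ => ((hΦp' j).sub (hΦm' j)).fun_pow 2).congr_deriv ?_
    rw [Finset.mul_sum]
    refine Finset.sum_congr rfl fun j _ => ?_
    simp only [Pi.sub_apply, hΦp_eq, hΦm_eq]
    norm_num
    ring
  -- the time derivative of the discrete Gauss law, tested with the potential
  have hGauss : ∀ j ∈ Finset.Icc 1 N_x,
      -polyPairing (X (j - 1)) (X j) (E' j) (Polynomial.derivative (Φh t j))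
          + (Ehat' (if j = N_x then 1 else j + 1) * (Φh t j).eval (X j)
            - Ehat' j * (Φh t j).eval (X (j - 1)))
        = (1 / α t) * polyPairing (X (j - 1)) (X j) (C 1 t j) (Polynomial.derivative (Φh t j))
          - (ghat 0 t (if j = N_x then 1 else j + 1) * (Φh t j).eval (X j)
            - ghat 0 t j * (Φh t j).eval (X (j - 1))) := by
    intro j hj
    have hleft : HasDerivAt (fun τ =>
        -polyPairing (X (j - 1)) (X j) (Eh τ j) (Polynomial.derivative (Φh t j))
          + (Ehat τ (if j = N_x then 1 else j + 1) * (Φh t j).eval (X j)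
            - Ehat τ j * (Φh t j).eval (X (j - 1)))) _ t :=
      (hE' j ((polyPairing (X (j - 1)) (X j)).flip (Polynomial.derivative (Φh t j)))).neg.add
        (((hEhat' _).mul_const _).sub ((hEhat' j).mul_const _))
    have hright := (hC0 t ht j hj (Φh t j) (hΦdeg t j)).sub_const
      (polyPairing (X (j - 1)) (X j) (Polynomial.C ρ₀) (Φh t j))
    refine (uniqueDiffWithinAt_Ici t).eq_deriv (Set.Ici t) hleft.hasDerivWithinAt
      (hright.hasDerivWithinAt.congr_of_mem (fun τ hτ => ?_) Set.self_mem_Ici)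
    have h := hLDG2 τ (ht.trans hτ) j hj (Φh t j) (hΦdeg t j)
    rw [← LinearMap.sub_apply, ← map_sub]
    simp only [polyPairing_apply, Polynomial.eval_sub, Polynomial.eval_C]
    rw [← h]
    ring
  have hPotential : ∀ η : ℕ → Polynomial ℝ, (∀ j, (η j).natDegree ≤ k) →
      ∑ j ∈ Finset.Icc 1 N_x,
          polyPairing (X (j - 1)) (X j) (Φh t j) (Polynomial.derivative (η j))
        + ∑ j ∈ Finset.Icc 1 N_x, (rightTrace X (Φh t) j + leftTrace N_x X (Φh t) j) / 2
          * (rightTrace X η j - leftTrace N_x X η j)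
        = ∑ j ∈ Finset.Icc 1 N_x, polyPairing (X (j - 1)) (X j) (Eh t j) (η j) := by
    intro η hη
    have h := Finset.sum_congr (rfl : Finset.Icc 1 N_x = _)
      fun j hj => hLDG1 t ht j hj (η j) (hη j)
    simp only [sub_add, ← polyPairing_apply] at h
    rw [Finset.sum_sub_distrib, sum_cell_flux] at h
    simp only [hΦhat, hΦp_eq, hΦm_eq] at h
    linarith
  have hGauss_sum := Finset.sum_congr rfl hGauss
  rw [Finset.sum_add_distrib, Finset.sum_neg_distrib, sum_cell_flux, Finset.sum_sub_distrib,
    sum_cell_flux, ← Finset.mul_sum] at hGauss_sum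
  have hghat_jump : ∑ j ∈ Finset.Icc 1 N_x, ghat 0 t j
        * (rightTrace X (Φh t) j - leftTrace N_x X (Φh t) j)
      = (1 / α t) * ∑ j ∈ Finset.Icc 1 N_x,
        (rightTrace X (C 1 t) j + leftTrace N_x X (C 1 t) j) / 2
          * (rightTrace X (Φh t) j - leftTrace N_x X (Φh t) j) := by
    simp only [hghat0, mul_assoc, Finset.mul_sum]
  have hEhat_jump : ∑ j ∈ Finset.Icc 1 N_x, Ehat' j
        * (rightTrace X (Φh t) j - leftTrace N_x X (Φh t) j)
      = ∑ j ∈ Finset.Icc 1 N_x, (rightTrace X E' j + leftTrace N_x X E' j) / 2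
          * (rightTrace X (Φh t) j - leftTrace N_x X (Φh t) j)
        - β * ∑ j ∈ Finset.Icc 1 N_x, (rightTrace X Φ' j - leftTrace N_x X Φ' j)
          * (rightTrace X (Φh t) j - leftTrace N_x X (Φh t) j) := by
    rw [Finset.mul_sum, ← Finset.sum_sub_distrib]
    exact Finset.sum_congr rfl fun j _ => by simp only [hEhat'_def]; ring
  have hparts : ∀ η : ℕ → Polynomial ℝ, (∀ j, (η j).natDegree ≤ k) →
      ∑ j ∈ Finset.Icc 1 N_x,
          polyPairing (X (j - 1)) (X j) (η j) (Polynomial.derivative (Φh t j))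
        + ∑ j ∈ Finset.Icc 1 N_x, (rightTrace X η j + leftTrace N_x X η j) / 2
          * (rightTrace X (Φh t) j - leftTrace N_x X (Φh t) j)
        = -∑ j ∈ Finset.Icc 1 N_x, polyPairing (X (j - 1)) (X j) (Eh t j) (η j) := by
    intro η hη
    have h := sum_polyPairing_derivative N_x X η (Φh t)
    simp only [polyPairing_comm _ _ (Polynomial.derivative (η _))] at h
    linarith [hPotential η hη]
  have hwork : (∑ j ∈ Finset.Icc 1 N_x, polyPairing (X (j - 1)) (X j) (Eh t j) (E' j))
      + β * ∑ j ∈ Finset.Icc 1 N_x, (rightTrace X Φ' j - leftTrace N_x X Φ' j)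
          * (rightTrace X (Φh t) j - leftTrace N_x X (Φh t) j)
      = -((1 / α t)
          * ∑ j ∈ Finset.Icc 1 N_x, polyPairing (X (j - 1)) (X j) (Eh t j) (C 1 t j)) := by
    have hE := hparts E' hE'deg
    have hC := congrArg ((1 / α t) * ·) (hparts (C 1 t) fun j => hdeg 1 t j)
    simp only [mul_add, mul_neg] at hC
    linarith
  have hαinv : HasDerivAt (fun τ => 1 / (α τ) ^ 2) (-(2 * αd t) / (α t) ^ 3) t := by
    refine (((hαderiv t ht).fun_pow 2).inv (pow_ne_zero 2 hαt)).congr_deriv ?_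
      |>.congr_of_eventuallyEq (.of_forall fun τ => by simp)
    norm_num
    field_simp
  refine ((((hαinv.mul ((hK2.const_mul (Real.sqrt 2)).add hK0)).add hEE).const_mul (1 / 2)).add
    (hJump.const_mul (β / 2))).congr_deriv ?_
  have hsqrt : Real.sqrt 2 * Real.sqrt 2 = 2 := Real.mul_self_sqrt (by norm_num)
  simp only [Pi.add_apply]
  generalize (∑ j ∈ Finset.Icc 1 N_x, polyPairing (X (j - 1)) (X j) (C 2 t j) 1) = K2
  generalize (∑ j ∈ Finset.Icc 1 N_x, polyPairing (X (j - 1)) (X j) (C 0 t j) 1) = K0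
  have hkin : -(2 * αd t) / (α t) ^ 3 * (Real.sqrt 2 * K2 + K0)
      + 1 / (α t) ^ 2 * (Real.sqrt 2 * ((αd t / α t) * (2 * K2 + Real.sqrt 2 * K0)
        + α t * Real.sqrt 2
          * ∑ j ∈ Finset.Icc 1 N_x, polyPairing (X (j - 1)) (X j) (Eh t j) (C 1 t j)) + 0)
      = 2 * ((1 / α t)
          * ∑ j ∈ Finset.Icc 1 N_x, polyPairing (X (j - 1)) (X j) (Eh t j) (C 1 t j)) := by
    field_simp
    linear_combination (αd t * K0 + (α t) ^ 2
      * ∑ j ∈ Finset.Icc 1 N_x, polyPairing (X (j - 1)) (X j) (Eh t j) (C 1 t j)) * hsqrt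
  linarith
end
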